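/- arXiv:math/9907026 — 3 statements merged into one kernel-verified Lean document; each statement's English description precedes it below -/
import Mathlib

section
/- Let (G,P) = Γ_{I∈Λ}(G_I,P_I) be a graph product of quasi-lattice ordered groups. Then the homomorphism φ : G → ⊕_{I∈Λ} G_I induced by the identity on each factor is order preserving, and whenever x, y ∈ P have a common upper bound in P the following hold: (a) φ(x) = φ(y) only if x = y; and (b) φ(x) ∨ φ(y) = φ(x ∨ y), where the join on the left is taken in the quasi-lattice ordered group (⊕_{I∈Λ} G_I, ⊕_{I∈Λ} P_I) with coordinatewise order. -/
universe u v

/-- A syllable: a vertex `I` of the graph together with a nontrivial element of `G I`. -/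
def Syllable {Λ : Type u} (G : Λ → Type v) [∀ I, Group (G I)] : Type (max u v) :=
  Σ I : Λ, {g : G I // g ≠ 1}

section Words

variable {Λ : Type u} {G : Λ → Type v} [∀ I, Group (G I)]

/-- A single shuffle: swap two consecutive syllables with adjacent vertices. -/
def ShuffleStep (adj : Λ → Λ → Prop) (L L' : List (Syllable G)) : Prop :=
  ∃ (A B : List (Syllable G)) (s t : Syllable G),
    adj s.1 t.1 ∧ L = A ++ s :: t :: B ∧ L' = A ++ t :: s :: B

/-- Shuffle equivalence: finitely many shuffles. -/
def ShuffleEquiv (adj : Λ → Λ → Prop) : List (Syllable G) → List (Syllable G) → Prop :=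
  Relation.ReflTransGen (ShuffleStep adj)

/-- An expression admits an amalgamation iff it has two consecutive syllables at the
same vertex. -/
def Amalgamable (L : List (Syllable G)) : Prop :=
  ∃ (A B : List (Syllable G)) (s t : Syllable G), s.1 = t.1 ∧ L = A ++ s :: t :: B

/-- An expression is reduced iff it is not shuffle equivalent to an expression
admitting an amalgamation. -/
def Reduced (adj : Λ → Λ → Prop) (L : List (Syllable G)) : Prop :=
  ¬ ∃ L', ShuffleEquiv adj L L' ∧ Amalgamable L'

/-- The syllable at position `i` is an initial syllable of the expression `L`:
its vertex is adjacent to the vertices of all earlier syllables. -/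
def InitialAt (adj : Λ → Λ → Prop) (L : List (Syllable G)) (i : Fin L.length) : Prop :=
  ∀ j : Fin L.length, j < i → adj (L.get j).1 (L.get i).1

end Words

section GroupPart

variable {Λ : Type u} (adj : Λ → Λ → Prop) (G : Λ → Type v) [∀ I, Group (G I)]

/-- The graph product of the family of groups `G` over the graph `adj`: the quotient of
the free product by the normal closure of the commutators coming from adjacent vertices. -/
def GraphProduct : Type (max u v) :=
  Monoid.CoprodI G ⧸ Subgroup.normalClosure
    {g : Monoid.CoprodI G | ∃ (I J : Λ) (x : G I) (y : G J), adj I J ∧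
      g = Monoid.CoprodI.of x * Monoid.CoprodI.of y *
          (Monoid.CoprodI.of x)⁻¹ * (Monoid.CoprodI.of y)⁻¹}

instance : Group (GraphProduct adj G) :=
  inferInstanceAs (Group (_ ⧸ _))

/-- The canonical image in the graph product of an element of one of the groups. -/
def mkOf {I : Λ} (g : G I) : GraphProduct adj G :=
  QuotientGroup.mk (Monoid.CoprodI.of g)

/-- Evaluation of an expression (a word in the syllables) in the graph product. -/
def evalWord (L : List (Syllable G)) : GraphProduct adj G :=
  (L.map fun s => mkOf adj G (s.2.1 : G s.1)).prod

/-- `L` is an expression for the group element `x`. -/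
def ExprFor (L : List (Syllable G)) (x : GraphProduct adj G) : Prop :=
  evalWord adj G L = x

/-- `s` is an initial syllable of the group element `x`: some reduced expression for `x`
has `s` as an initial syllable. -/
def IsInitialSyllable (x : GraphProduct adj G) (s : Syllable G) : Prop :=
  ∃ L, Reduced adj L ∧ ExprFor adj G L x ∧ ∃ i : Fin L.length, InitialAt adj L i ∧ L.get i = s

/-- `s` is a final syllable of the group element `x`: it is an initial syllable of the
reverse of some reduced expression for `x`. -/
def IsFinalSyllable (x : GraphProduct adj G) (s : Syllable G) : Prop :=
  ∃ L, Reduced adj L ∧ ExprFor adj G L x ∧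
    ∃ i : Fin L.reverse.length, InitialAt adj L.reverse i ∧ L.reverse.get i = s

/-- `I` is an initial vertex of the group element `x`, i.e. `I ∈ Δ(x)`. -/
def InitialVertexOf (x : GraphProduct adj G) (I : Λ) : Prop :=
  ∃ s : Syllable G, IsInitialSyllable adj G x s ∧ s.1 = I

/-- `I` is a final vertex of the group element `x`, i.e. `I ∈ Δʳ(x)`. -/
def FinalVertexOf (x : GraphProduct adj G) (I : Λ) : Prop :=
  ∃ s : Syllable G, IsFinalSyllable adj G x s ∧ s.1 = I

/-- `I` is a vertex of the group element `x`: some (hence any) reduced expression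
for `x` has a syllable at the vertex `I`. -/
def VertexOf (x : GraphProduct adj G) (I : Λ) : Prop :=
  ∃ L, Reduced adj L ∧ ExprFor adj G L x ∧ ∃ s ∈ L, Sigma.fst s = I

/-- `c` is the element `x_I ∈ G_I`: either `c` is nontrivial and the initial syllable of
`x` at the vertex `I`, or `c = 1` and `I` is not an initial vertex of `x`. -/
def InitialPart (x : GraphProduct adj G) (I : Λ) (c : G I) : Prop :=
  (∃ h : c ≠ 1, IsInitialSyllable adj G x ⟨I, ⟨c, h⟩⟩) ∨ (c = 1 ∧ ¬ InitialVertexOf adj G x I)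

/-- The positive cone of the graph product of partially ordered groups: the submonoid
generated by the union of the positive cones of the factors. -/
def posCone (Pc : ∀ I, Submonoid (G I)) : Submonoid (GraphProduct adj G) :=
  Submonoid.closure {g | ∃ (I : Λ) (p : G I), p ∈ Pc I ∧ g = mkOf adj G p}

end GroupPart

section Order

variable {H : Type*} [Group H]

/-- `x ≤ y` in the left-invariant partial order determined by the cone `P`. -/
def lle (P : Submonoid H) (x y : H) : Prop := x⁻¹ * y ∈ P

/-- `x ≤ᵣ y` in the right-invariant partial order determined by the cone `P`. -/
def rle (P : Submonoid H) (x y : H) : Prop := y * x⁻¹ ∈ P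

/-- `x` and `y` have a common upper bound for the left-invariant order. -/
def HasUB (P : Submonoid H) (x y : H) : Prop := ∃ z, lle P x z ∧ lle P y z

/-- `m` is a least upper bound of `x` and `y` for the left-invariant order. -/
def IsLub' (P : Submonoid H) (x y m : H) : Prop :=
  lle P x m ∧ lle P y m ∧ ∀ w, lle P x w → lle P y w → lle P m w

/-- `w` is a greatest lower bound of `u` and `v` for the right-invariant order. -/
def IsRGlb (P : Submonoid H) (u v w : H) : Prop :=
  rle P w u ∧ rle P w v ∧ ∀ z, rle P z u → rle P z v → rle P z w

/-- `(H,P)` is a partially ordered group: `P ∩ P⁻¹ = {1}`. -/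
def IsPoGroup (P : Submonoid H) : Prop := ∀ x : H, x ∈ P → x⁻¹ ∈ P → x = 1

/-- `(H,P)` is a quasi-lattice ordered group: it is a partially ordered group in which
every pair of elements with a common upper bound has a least upper bound. -/
def IsQLO (P : Submonoid H) : Prop :=
  IsPoGroup P ∧ ∀ x y : H, HasUB P x y → ∃ m, IsLub' P x y m

end Order

/-- The homomorphism `φ` from the graph product to the direct product `∀ I, G I`,
restricting to the identity on each factor (each factor is sent to the corresponding
coordinate). -/
def phi {Λ : Type u} [DecidableEq Λ] (adj : Λ → Λ → Prop) (G : Λ → Type v)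
    [∀ I, Group (G I)] (hirr : ∀ I : Λ, ¬ adj I I) :
    GraphProduct adj G →* (∀ I, G I) :=
  QuotientGroup.lift _ (Monoid.CoprodI.lift fun I => MonoidHom.mulSingle G I)
    (Subgroup.normalClosure_le_normal (by
      rintro g ⟨I, J, x, y, hadj, rfl⟩
      have hIJ : I ≠ J := fun h => hirr J (h ▸ hadj)
      have hc : Commute (Pi.mulSingle I x) (Pi.mulSingle J y) :=
        Pi.mulSingle_commute hIJ x y
      simp only [SetLike.mem_coe, MonoidHom.mem_ker, map_mul, map_inv,
        Monoid.CoprodI.lift_of, MonoidHom.mulSingle_apply]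
      rw [hc.eq]
      group))

/-- The positive cone of the direct product of the partially ordered groups
`(G_I, P_I)`, ordered coordinatewise. -/
def piCone {Λ : Type u} (G : Λ → Type v) [∀ I, Group (G I)]
    (Pc : ∀ I, Submonoid (G I)) : Submonoid (∀ I, G I) :=
  Submonoid.pi Set.univ Pc

section Lub

variable {H : Type*} [Group H] {P : Submonoid H}

theorem lle_mul_left_iff (g x y : H) : lle P (g * x) (g * y) ↔ lle P x y := by
  simp [lle, mul_assoc]

theorem lle_mul_left_iff' (g x y : H) : lle P (g * x) y ↔ lle P x (g⁻¹ * y) := by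
  simp [lle, mul_assoc]

theorem lle_self_mul (x : H) {p : H} (hp : p ∈ P) : lle P x (x * p) := by
  simpa [lle] using hp

theorem lle_one_iff (x : H) : lle P 1 x ↔ x ∈ P := by
  simp [lle]

theorem lle_refl (x : H) : lle P x x := by
  simp [lle]

theorem lle_trans {x y z : H} (hxy : lle P x y) (hyz : lle P y z) : lle P x z := by
  have := mul_mem hxy hyz
  simpa [lle, mul_assoc] using this

theorem IsPoGroup.lle_antisymm (hP : IsPoGroup P) {x y : H} (hxy : lle P x y)
    (hyx : lle P y x) : x = y :=
  inv_mul_eq_one.1 (hP _ hxy (by simpa [lle] using hyx))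

theorem IsPoGroup.eq_one_of_mul_eq_one (hP : IsPoGroup P) {p q : H} (hp : p ∈ P)
    (hq : q ∈ P) (h : p * q = 1) : p = 1 :=
  hP p hp (by rwa [inv_eq_of_mul_eq_one_right h])

theorem IsLub'.symm {x y m : H} (h : IsLub' P x y m) : IsLub' P y x m :=
  ⟨h.2.1, h.1, fun w hy hx => h.2.2 w hx hy⟩

theorem isLub'_of_lle {x y : H} (h : lle P x y) : IsLub' P x y y :=
  ⟨h, lle_refl y, fun _ _ hy => hy⟩

theorem IsLub'.mul_left {x y m : H} (h : IsLub' P x y m) (g : H) :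
    IsLub' P (g * x) (g * y) (g * m) := by
  refine ⟨(lle_mul_left_iff g _ _).2 h.1, (lle_mul_left_iff g _ _).2 h.2.1, fun w hx hy => ?_⟩
  rw [lle_mul_left_iff'] at hx hy ⊢
  exact h.2.2 _ hx hy

/-- If `k = p ∨ y` and `m = x ∨ k` with `p ≤ x`, then `m = x ∨ y`. -/
theorem IsLub'.of_lle {p x y k m : H} (hk : IsLub' P p y k) (hm : IsLub' P x k m)
    (hpx : lle P p x) : IsLub' P x y m :=
  ⟨hm.1, lle_trans hk.2.1 hm.2.1, fun w hx hy =>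
    hm.2.2 w hx (hk.2.2 w (lle_trans hpx hx) hy)⟩

end Lub

section PiCone

variable {Λ : Type u} {G : Λ → Type v} [∀ I, Group (G I)] {Pc : ∀ I, Submonoid (G I)}

theorem lle_piCone_iff (x y : ∀ I, G I) :
    lle (piCone G Pc) x y ↔ ∀ I, lle (Pc I) (x I) (y I) := by
  simp [lle, piCone, Submonoid.mem_pi]

theorem isPoGroup_piCone (hP : ∀ I, IsPoGroup (Pc I)) : IsPoGroup (piCone G Pc) := by
  intro x hx hx'
  simp only [piCone, Submonoid.mem_pi, Set.mem_univ, true_implies] at hx hx'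
  exact funext fun I => hP I _ (hx I) (hx' I)

theorem isLub'_piCone {x y m : ∀ I, G I} (h : ∀ I, IsLub' (Pc I) (x I) (y I) (m I)) :
    IsLub' (piCone G Pc) x y m := by
  simp only [IsLub', lle_piCone_iff]
  exact ⟨fun I => (h I).1, fun I => (h I).2.1, fun w hx hy I => (h I).2.2 _ (hx I) (hy I)⟩

theorem mulSingle_mem_piCone [DecidableEq Λ] {I : Λ} {p : G I} (hp : p ∈ Pc I) :
    Pi.mulSingle I p ∈ piCone G Pc := by
  intro K _
  obtain rfl | h := eq_or_ne K I
  · simpa using hp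
  · simp [h]

end PiCone

section FirstPart

open Monoid

variable {Λ : Type u} {G : Λ → Type v} [∀ I, Group (G I)] {Pc : ∀ I, Submonoid (G I)}

/-- The submonoid of a free product generated by the positive cones of the factors. -/
def coprodCone (Pc : ∀ I, Submonoid (G I)) : Submonoid (CoprodI G) :=
  ⨆ I, (Pc I).map CoprodI.of

theorem of_mem_coprodCone {I : Λ} {p : G I} (hp : p ∈ Pc I) :
    CoprodI.of p ∈ coprodCone Pc :=
  Submonoid.mem_iSup_of_mem I (Submonoid.mem_map_of_mem _ hp)

variable [DecidableEq Λ] [∀ I, DecidableEq (G I)]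

/-- The first syllable of an element of a free product if it lies in `G I`, and `1` otherwise. -/
def firstPart (I : Λ) (w : CoprodI G) : G I :=
  (CoprodI.Word.equivPair I (w • (CoprodI.Word.empty : CoprodI.Word G))).head

theorem firstPart_one (I : Λ) : firstPart I (1 : CoprodI G) = 1 := by
  rw [firstPart, one_smul, CoprodI.Word.equivPair_eq_of_fstIdx_ne (by simp [CoprodI.Word.fstIdx])]

theorem firstPart_of_mul_same {I : Λ} (p : G I) (w : CoprodI G) :
    firstPart I (CoprodI.of p * w) = p * firstPart I w := by
  rw [firstPart, mul_smul, CoprodI.Word.equivPair_smul_same]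
  rfl

theorem firstPart_of_mul_of_ne {I J : Λ} (h : I ≠ J) (q : G J) (w : CoprodI G)
    (hq : q * firstPart J w ≠ 1) : firstPart I (CoprodI.of q * w) = 1 := by
  rw [firstPart, mul_smul, CoprodI.Word.of_smul_def, CoprodI.Word.rcons]
  split_ifs with h1
  · exact absurd h1 hq
  · rw [CoprodI.Word.equivPair_eq_of_fstIdx_ne]
    simpa using h.symm

theorem firstPart_mem (hP : ∀ I, IsPoGroup (Pc I)) {w : CoprodI G} (hw : w ∈ coprodCone Pc) :
    ∀ I, firstPart I w ∈ Pc I := by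
  rw [coprodCone, Submonoid.iSup_eq_closure] at hw
  induction hw using Submonoid.closure_induction_left with
  | one => intro I; rw [firstPart_one]; exact one_mem _
  | mul_left x hx y _ ih =>
    obtain ⟨J, q, hq, rfl⟩ := Set.mem_iUnion.1 hx
    intro I
    obtain rfl | hIJ := eq_or_ne I J
    · rw [firstPart_of_mul_same]
      exact mul_mem hq (ih I)
    · by_cases h1 : q * firstPart J y = 1
      · rw [(hP J).eq_one_of_mul_eq_one hq (ih J) h1, map_one, one_mul]
        exact ih I
      · rw [firstPart_of_mul_of_ne hIJ q y h1]
        exact one_mem _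

theorem firstPart_of_mul_eq_one (hP : ∀ I, IsPoGroup (Pc I)) {I J : Λ} (h : I ≠ J) {q : G J}
    (hq : q ∈ Pc J) (hq1 : q ≠ 1) {w : CoprodI G} (hw : w ∈ coprodCone Pc) :
    firstPart I (CoprodI.of q * w) = 1 :=
  firstPart_of_mul_of_ne h q w fun h1 =>
    hq1 ((hP J).eq_one_of_mul_eq_one hq (firstPart_mem hP hw J) h1)

end FirstPart

section GraphProductCone

open Monoid

variable {Λ : Type u} {adj : Λ → Λ → Prop} {G : Λ → Type v} [∀ I, Group (G I)]
  {Pc : ∀ I, Submonoid (G I)}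

theorem mkOf_one (I : Λ) : mkOf adj G (1 : G I) = 1 := by
  rw [mkOf, map_one]; rfl

theorem mkOf_mul {I : Λ} (p q : G I) : mkOf adj G (p * q) = mkOf adj G p * mkOf adj G q := by
  rw [mkOf, map_mul]; rfl

theorem mkOf_inv {I : Λ} (p : G I) : mkOf adj G p⁻¹ = (mkOf adj G p)⁻¹ := by
  rw [mkOf, map_inv]; rfl

theorem mkOf_mul_comm {I J : Λ} (h : adj I J) (p : G I) (q : G J) :
    mkOf adj G p * mkOf adj G q = mkOf adj G q * mkOf adj G p := by
  have : mkOf adj G p * mkOf adj G q * (mkOf adj G p)⁻¹ * (mkOf adj G q)⁻¹ = 1 :=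
    (QuotientGroup.eq_one_iff _).2 (Subgroup.subset_normalClosure ⟨I, J, p, q, h, rfl⟩)
  rwa [mul_inv_eq_one, mul_inv_eq_iff_eq_mul] at this

theorem mkOf_mem_posCone {I : Λ} {p : G I} (hp : p ∈ Pc I) : mkOf adj G p ∈ posCone adj G Pc :=
  Submonoid.subset_closure ⟨I, p, hp, rfl⟩

theorem lle_mkOf {I : Λ} {p q : G I} (h : lle (Pc I) p q) :
    lle (posCone adj G Pc) (mkOf adj G p) (mkOf adj G q) := by
  rw [lle, ← mkOf_inv, ← mkOf_mul]
  exact mkOf_mem_posCone h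

@[elab_as_elim]
theorem posCone_induction {motive : (z : GraphProduct adj G) → z ∈ posCone adj G Pc → Prop}
    (one : motive 1 (one_mem _))
    (mkOf_mul : ∀ (I : Λ) (p : G I) (hp : p ∈ Pc I) (z : GraphProduct adj G)
      (hz : z ∈ posCone adj G Pc), motive z hz →
      motive (mkOf adj G p * z) (mul_mem (mkOf_mem_posCone hp) hz))
    {z : GraphProduct adj G} (hz : z ∈ posCone adj G Pc) : motive z hz := by
  induction hz using Submonoid.closure_induction_left with
  | one => exact one
  | mul_left x hx y hy ih =>
    obtain ⟨I, p, hp, rfl⟩ := hx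
    exact mkOf_mul I p hp y hy ih

variable [DecidableEq Λ]

theorem phi_mkOf (hirr : ∀ I : Λ, ¬ adj I I) {I : Λ} (p : G I) :
    phi adj G hirr (mkOf adj G p) = Pi.mulSingle I p :=
  (QuotientGroup.lift_mk _ _ _).trans (by simp)

theorem phi_mem_piCone (hirr : ∀ I : Λ, ¬ adj I I) {z : GraphProduct adj G}
    (hz : z ∈ posCone adj G Pc) : phi adj G hirr z ∈ piCone G Pc := by
  induction hz using posCone_induction with
  | one => rw [map_one]; exact one_mem _
  | mkOf_mul I p hp z _ ih =>
    rw [map_mul, phi_mkOf]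
    exact mul_mem (mulSingle_mem_piCone hp) ih

theorem lle_phi (hirr : ∀ I : Λ, ¬ adj I I) {x y : GraphProduct adj G}
    (h : lle (posCone adj G Pc) x y) :
    lle (piCone G Pc) (phi adj G hirr x) (phi adj G hirr y) := by
  simpa [lle] using phi_mem_piCone hirr h

theorem lle_phi_of_mkOf_lle (hirr : ∀ I : Λ, ¬ adj I I) {I : Λ} {p : G I}
    {z : GraphProduct adj G} (h : lle (posCone adj G Pc) (mkOf adj G p) z) :
    lle (Pc I) p (phi adj G hirr z I) := by
  simpa [phi_mkOf] using (lle_piCone_iff _ _).1 (lle_phi hirr h) I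

theorem phi_mkOf_mul_apply_same (hirr : ∀ I : Λ, ¬ adj I I) {I : Λ} (p : G I)
    (z : GraphProduct adj G) :
    phi adj G hirr (mkOf adj G p * z) I = p * phi adj G hirr z I := by
  simp [phi_mkOf]

theorem phi_mkOf_mul_apply_of_ne (hirr : ∀ I : Λ, ¬ adj I I) {I K : Λ} (h : I ≠ K) (r : G K)
    (z : GraphProduct adj G) :
    phi adj G hirr (mkOf adj G r * z) I = phi adj G hirr z I := by
  simp [phi_mkOf, h]

theorem eq_one_of_phi_eq_one (hP : ∀ I, IsPoGroup (Pc I)) (hirr : ∀ I : Λ, ¬ adj I I)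
    {z : GraphProduct adj G} (hz : z ∈ posCone adj G Pc) (h : phi adj G hirr z = 1) : z = 1 := by
  induction hz using posCone_induction with
  | one => rfl
  | mkOf_mul I p hp z hz ih =>
    rw [map_mul, phi_mkOf] at h
    have h1 := (isPoGroup_piCone hP).eq_one_of_mul_eq_one (mulSingle_mem_piCone hp)
      (phi_mem_piCone hirr hz) h
    rw [h1, one_mul] at h
    rw [ih h, Pi.mulSingle_eq_one_iff.1 h1, mkOf_one, one_mul]

end GraphProductCone

section PairProj

open Monoid

variable {Λ : Type u} [DecidableEq Λ] {adj : Λ → Λ → Prop} {G : Λ → Type v} [∀ I, Group (G I)]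
  {Pc : ∀ I, Submonoid (G I)} (hsymm : Symmetric adj) (hirr : ∀ I : Λ, ¬ adj I I)
  {I J : Λ} (hIJ : ¬ adj I J)

/-- For nonadjacent vertices `I` and `J`, the homomorphism to the free product which is the
identity on `G I` and `G J` and trivial on the other factors. -/
def pairProj : GraphProduct adj G →* CoprodI G :=
  QuotientGroup.lift _
    (CoprodI.lift fun K => if K = I ∨ K = J then CoprodI.of else (1 : G K →* CoprodI G))
    (Subgroup.normalClosure_le_normal (by
      rintro g ⟨K, L, x, y, hadj, rfl⟩
      simp only [SetLike.mem_coe, MonoidHom.mem_ker, map_mul, map_inv, CoprodI.lift_of]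
      by_cases hK : K = I ∨ K = J
      · have hL : ¬ (L = I ∨ L = J) := by
          rintro (rfl | rfl) <;> rcases hK with rfl | rfl
          exacts [hirr _ hadj, hIJ (hsymm hadj), hIJ hadj, hirr _ hadj]
        simp [hL]
      · simp [hK]))

theorem pairProj_mkOf {K : Λ} (p : G K) :
    pairProj hsymm hirr hIJ (mkOf adj G p) =
      (if K = I ∨ K = J then CoprodI.of else (1 : G K →* CoprodI G)) p :=
  (QuotientGroup.lift_mk _ _ _).trans (by simp)

theorem pairProj_mem {z : GraphProduct adj G} (hz : z ∈ posCone adj G Pc) :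
    pairProj hsymm hirr hIJ z ∈ coprodCone Pc := by
  induction hz using posCone_induction with
  | one => rw [map_one]; exact one_mem _
  | mkOf_mul K p hp z _ ih =>
    rw [map_mul, pairProj_mkOf]
    refine mul_mem ?_ ih
    split_ifs
    · exact of_mem_coprodCone hp
    · exact one_mem _

variable [∀ I, DecidableEq (G I)]

/-- The initial `G I`-part of the projection of `z` to the free product of `G I` and `G J`. -/
def pairFirst (z : GraphProduct adj G) : G I :=
  firstPart I (pairProj hsymm hirr hIJ z)

theorem pairFirst_mem (hP : ∀ I, IsPoGroup (Pc I)) {z : GraphProduct adj G}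
    (hz : z ∈ posCone adj G Pc) : pairFirst hsymm hirr hIJ z ∈ Pc I :=
  firstPart_mem hP (pairProj_mem hsymm hirr hIJ hz) I

theorem pairFirst_mkOf_mul_same (p : G I) (z : GraphProduct adj G) :
    pairFirst hsymm hirr hIJ (mkOf adj G p * z) = p * pairFirst hsymm hirr hIJ z := by
  rw [pairFirst, map_mul, pairProj_mkOf, if_pos (Or.inl rfl), firstPart_of_mul_same]
  rfl

theorem pairFirst_mkOf_mul_of_ne {K : Λ} (hI : K ≠ I) (hJ : K ≠ J) (r : G K)
    (z : GraphProduct adj G) :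
    pairFirst hsymm hirr hIJ (mkOf adj G r * z) = pairFirst hsymm hirr hIJ z := by
  rw [pairFirst, map_mul, pairProj_mkOf, if_neg (by tauto), MonoidHom.one_apply, one_mul]
  rfl

theorem pairFirst_mkOf_mul_eq_one (hP : ∀ I, IsPoGroup (Pc I)) (hne : I ≠ J) {q : G J}
    (hq : q ∈ Pc J) (hq1 : q ≠ 1) {z : GraphProduct adj G} (hz : z ∈ posCone adj G Pc) :
    pairFirst hsymm hirr hIJ (mkOf adj G q * z) = 1 := by
  rw [pairFirst, map_mul, pairProj_mkOf, if_pos (Or.inr rfl)]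
  exact firstPart_of_mul_eq_one hP hne hq hq1 (pairProj_mem hsymm hirr hIJ hz)

/-- A positive element `z` has an initial `G I`-part `a`, which is visible either in the `I`-th
coordinate of `phi` or in one of the projections to free products of two factors. -/
theorem exists_initial_part (hP : ∀ I, IsPoGroup (Pc I)) (I : Λ) {z : GraphProduct adj G}
    (hz : z ∈ posCone adj G Pc) :
    ∃ a : G I, lle (posCone adj G Pc) (mkOf adj G a) z ∧
      (a = phi adj G hirr z I ∨
        ∃ (J : Λ) (h : ¬ adj I J), I ≠ J ∧ a = pairFirst hsymm hirr h z) := by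
  induction hz using posCone_induction with
  | one => exact ⟨1, by rw [mkOf_one]; exact lle_refl _, Or.inl (by simp)⟩
  | mkOf_mul K r hr z hz ih =>
    by_cases hr1 : r = 1
    · simpa [hr1, mkOf_one] using ih
    obtain ⟨a, haz, ha⟩ := ih
    obtain rfl | hIK := eq_or_ne I K
    · refine ⟨r * a, by rwa [mkOf_mul, lle_mul_left_iff], ?_⟩
      simpa only [phi_mkOf_mul_apply_same, pairFirst_mkOf_mul_same, mul_right_inj] using ha
    by_cases hadj : adj I K
    · refine ⟨a, ?_, ?_⟩
      · refine lle_trans (lle_self_mul _ (mkOf_mem_posCone hr)) ?_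
        rwa [mkOf_mul_comm hadj, lle_mul_left_iff]
      · rw [phi_mkOf_mul_apply_of_ne hirr hIK]
        refine ha.imp_right ?_
        rintro ⟨J, hJ, hne, ha⟩
        refine ⟨J, hJ, hne, ?_⟩
        rwa [pairFirst_mkOf_mul_of_ne _ _ _ hIK.symm (by rintro rfl; exact hJ hadj)]
    · refine ⟨1, ?_, Or.inr ⟨K, hadj, hIK, ?_⟩⟩
      · rw [mkOf_one, lle_one_iff]
        exact mul_mem (mkOf_mem_posCone hr) hz
      · rw [pairFirst_mkOf_mul_eq_one _ _ _ hP hIK hr hr1 hz]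

theorem mkOf_lle_of_forall (hP : ∀ I, IsPoGroup (Pc I)) {p : G I} {z : GraphProduct adj G}
    (hz : z ∈ posCone adj G Pc) (hphi : lle (Pc I) p (phi adj G hirr z I))
    (hfirst : ∀ (J : Λ) (h : ¬ adj I J), I ≠ J → lle (Pc I) p (pairFirst hsymm hirr h z)) :
    lle (posCone adj G Pc) (mkOf adj G p) z := by
  obtain ⟨a, haz, rfl | ⟨J, h, hne, rfl⟩⟩ := exists_initial_part hsymm hirr hP I hz
  · exact lle_trans (lle_mkOf hphi) haz
  · exact lle_trans (lle_mkOf (hfirst J h hne)) haz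

theorem lle_pairFirst_of_mkOf_lle (hP : ∀ I, IsPoGroup (Pc I)) {p : G I}
    {z : GraphProduct adj G} (h : lle (posCone adj G Pc) (mkOf adj G p) z) :
    lle (Pc I) p (pairFirst hsymm hirr hIJ z) := by
  have hz := pairFirst_mem hsymm hirr hIJ hP h
  rwa [← mkOf_inv, pairFirst_mkOf_mul_same] at hz

end PairProj

section Join

variable {Λ : Type u} [DecidableEq Λ] {adj : Λ → Λ → Prop} {G : Λ → Type v} [∀ I, Group (G I)]
  {Pc : ∀ I, Submonoid (G I)}

theorem adj_of_mkOf_lle (hsymm : Symmetric adj) (hirr : ∀ I : Λ, ¬ adj I I)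
    (hP : ∀ I, IsPoGroup (Pc I)) {I J : Λ} (hne : I ≠ J) {p : G I} {q : G J}
    (hp : p ∈ Pc I) (hq : q ∈ Pc J) (hp1 : p ≠ 1) (hq1 : q ≠ 1) {z : GraphProduct adj G}
    (hpz : lle (posCone adj G Pc) (mkOf adj G p) z)
    (hqz : lle (posCone adj G Pc) (mkOf adj G q) z) : adj I J := by
  classical
  by_contra hIJ
  have h := lle_pairFirst_of_mkOf_lle hsymm hirr hIJ hP hpz
  rw [← mul_inv_cancel_left (mkOf adj G q) z,
    pairFirst_mkOf_mul_eq_one hsymm hirr hIJ hP hne hq hq1 hqz] at h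
  exact hp1 (hP I p hp (by simpa [lle] using h))

theorem mkOf_lle_of_adj (hsymm : Symmetric adj) (hirr : ∀ I : Λ, ¬ adj I I)
    (hP : ∀ I, IsPoGroup (Pc I)) {I J : Λ} (hadj : adj I J) {p : G I} {q : G J}
    {z : GraphProduct adj G}
    (hpz : lle (posCone adj G Pc) (mkOf adj G p) z)
    (hqz : lle (posCone adj G Pc) (mkOf adj G q) z) :
    lle (posCone adj G Pc) (mkOf adj G p) ((mkOf adj G q)⁻¹ * z) := by
  classical
  have hne : I ≠ J := by rintro rfl; exact hirr _ hadj
  refine mkOf_lle_of_forall hsymm hirr hP hqz ?_ fun K hK _ => ?_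
  · rw [← mkOf_inv, phi_mkOf_mul_apply_of_ne hirr hne]
    exact lle_phi_of_mkOf_lle hirr hpz
  · rw [← mkOf_inv, pairFirst_mkOf_mul_of_ne _ _ _ hne.symm (by rintro rfl; exact hK hadj)]
    exact lle_pairFirst_of_mkOf_lle hsymm hirr hK hP hpz

theorem mkOf_lub_lle (hsymm : Symmetric adj) (hirr : ∀ I : Λ, ¬ adj I I)
    (hP : ∀ I, IsPoGroup (Pc I)) {I : Λ} {p q m : G I} (hm : IsLub' (Pc I) p q m)
    {z : GraphProduct adj G} (hz : z ∈ posCone adj G Pc)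
    (hpz : lle (posCone adj G Pc) (mkOf adj G p) z)
    (hqz : lle (posCone adj G Pc) (mkOf adj G q) z) :
    lle (posCone adj G Pc) (mkOf adj G m) z := by
  classical
  exact mkOf_lle_of_forall hsymm hirr hP hz
    (hm.2.2 _ (lle_phi_of_mkOf_lle hirr hpz) (lle_phi_of_mkOf_lle hirr hqz))
    fun K hK _ => hm.2.2 _ (lle_pairFirst_of_mkOf_lle hsymm hirr hK hP hpz)
      (lle_pairFirst_of_mkOf_lle hsymm hirr hK hP hqz)

theorem exists_join_mkOf_mkOf (hsymm : Symmetric adj) (hirr : ∀ I : Λ, ¬ adj I I)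
    (hqlo : ∀ I, IsQLO (Pc I)) {I J : Λ} {p : G I} {q : G J} (hp : p ∈ Pc I) (hq : q ∈ Pc J)
    {z : GraphProduct adj G} (hz : z ∈ posCone adj G Pc)
    (hpz : lle (posCone adj G Pc) (mkOf adj G p) z)
    (hqz : lle (posCone adj G Pc) (mkOf adj G q) z) :
    ∃ p' ∈ Pc I, lle (posCone adj G Pc) (mkOf adj G p) (mkOf adj G q * mkOf adj G p') ∧
      lle (posCone adj G Pc) (mkOf adj G q * mkOf adj G p') z ∧
      IsLub' (piCone G Pc) (phi adj G hirr (mkOf adj G p)) (phi adj G hirr (mkOf adj G q))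
        (phi adj G hirr (mkOf adj G q * mkOf adj G p')) := by
  classical
  have hP : ∀ I, IsPoGroup (Pc I) := fun I => (hqlo I).1
  obtain rfl | hne := eq_or_ne I J
  · obtain ⟨m, hm⟩ := (hqlo I).2 p q
      ⟨_, lle_phi_of_mkOf_lle hirr hpz, lle_phi_of_mkOf_lle hirr hqz⟩
    refine ⟨q⁻¹ * m, hm.2.1, ?_⟩
    rw [← mkOf_mul, mul_inv_cancel_left]
    refine ⟨lle_mkOf hm.1, mkOf_lub_lle hsymm hirr hP hm hz hpz hqz, ?_⟩
    simp only [phi_mkOf]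
    refine isLub'_piCone fun K => ?_
    obtain rfl | hK := eq_or_ne K I
    · simpa using hm
    · simpa [hK] using isLub'_of_lle (lle_refl 1)
  · refine ⟨p, hp, ?_⟩
    have key : lle (posCone adj G Pc) (mkOf adj G p) (mkOf adj G q * mkOf adj G p) ∧
        lle (posCone adj G Pc) (mkOf adj G q * mkOf adj G p) z := by
      by_cases hp1 : p = 1
      · subst hp1
        simpa [mkOf_one, lle_one_iff] using ⟨mkOf_mem_posCone hq, hqz⟩
      by_cases hq1 : q = 1
      · subst hq1
        simpa [mkOf_one] using ⟨lle_refl _, hpz⟩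
      have hadj := adj_of_mkOf_lle hsymm hirr hP hne hp hq hp1 hq1 hpz hqz
      refine ⟨?_, ?_⟩
      · rw [← mkOf_mul_comm hadj]
        exact lle_self_mul _ (mkOf_mem_posCone hq)
      · rw [lle_mul_left_iff']
        exact mkOf_lle_of_adj hsymm hirr hP hadj hpz hqz
    refine ⟨key.1, key.2, ?_⟩
    simp only [map_mul, phi_mkOf]
    refine isLub'_piCone fun K => ?_
    obtain rfl | hKI := eq_or_ne K I
    · simpa [hne] using (isLub'_of_lle ((lle_one_iff p).2 hp)).symm
    · simpa [hKI] using isLub'_of_lle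
        ((lle_one_iff _).2 (mulSingle_mem_piCone hq K (Set.mem_univ K)))

theorem exists_join_mkOf (hsymm : Symmetric adj) (hirr : ∀ I : Λ, ¬ adj I I)
    (hqlo : ∀ I, IsQLO (Pc I)) {I : Λ} {y : GraphProduct adj G} (hy : y ∈ posCone adj G Pc) :
    ∀ {p : G I}, p ∈ Pc I → ∀ {z : GraphProduct adj G}, z ∈ posCone adj G Pc →
    lle (posCone adj G Pc) (mkOf adj G p) z → lle (posCone adj G Pc) y z →
    ∃ p' ∈ Pc I, lle (posCone adj G Pc) (mkOf adj G p) (y * mkOf adj G p') ∧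
      lle (posCone adj G Pc) (y * mkOf adj G p') z ∧
      IsLub' (piCone G Pc) (phi adj G hirr (mkOf adj G p)) (phi adj G hirr y)
        (phi adj G hirr (y * mkOf adj G p')) := by
  induction hy using posCone_induction with
  | one =>
    intro p hp z _ hpz _
    refine ⟨p, hp, ?_⟩
    rw [one_mul]
    refine ⟨lle_refl _, hpz, ?_⟩
    rw [map_one]
    exact (isLub'_of_lle ((lle_one_iff _).2 (phi_mem_piCone hirr (mkOf_mem_posCone hp)))).symm
  | mkOf_mul J q hq y hy ih =>
    intro p hp z hz hpz hyz
    have hqz := lle_trans (lle_self_mul (mkOf adj G q) hy) hyz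
    obtain ⟨p₁, hp₁, h₁, h₁z, hlub₁⟩ := exists_join_mkOf_mkOf hsymm hirr hqlo hp hq hz hpz hqz
    rw [lle_mul_left_iff'] at h₁z hyz
    obtain ⟨p₂, hp₂, h₂, h₂z, hlub₂⟩ := ih hp₁ hqz h₁z hyz
    rw [← lle_mul_left_iff', ← mul_assoc] at h₂z
    rw [← lle_mul_left_iff (mkOf adj G q), ← mul_assoc] at h₂
    refine ⟨p₂, hp₂, lle_trans h₁ h₂, h₂z, ?_⟩
    have hlub := hlub₂.mul_left (phi adj G hirr (mkOf adj G q))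
    simp only [← map_mul, ← mul_assoc] at hlub
    exact (hlub₁.symm.of_lle hlub.symm (lle_phi hirr (lle_self_mul _ hy))).symm

/-- Two positive elements `x, y ≤ z` have a common upper bound below `z` which is mapped by `phi`
to the least upper bound of their images. -/
theorem exists_join (hsymm : Symmetric adj) (hirr : ∀ I : Λ, ¬ adj I I)
    (hqlo : ∀ I, IsQLO (Pc I)) {x : GraphProduct adj G} (hx : x ∈ posCone adj G Pc) :
    ∀ {y z : GraphProduct adj G}, y ∈ posCone adj G Pc → z ∈ posCone adj G Pc →
    lle (posCone adj G Pc) x z → lle (posCone adj G Pc) y z →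
    ∃ m, lle (posCone adj G Pc) x m ∧ lle (posCone adj G Pc) y m ∧
      lle (posCone adj G Pc) m z ∧
      IsLub' (piCone G Pc) (phi adj G hirr x) (phi adj G hirr y) (phi adj G hirr m) := by
  induction hx using posCone_induction with
  | one =>
    intro y z hy _ _ hyz
    refine ⟨y, (lle_one_iff y).2 hy, lle_refl y, hyz, ?_⟩
    rw [map_one]
    exact isLub'_of_lle ((lle_one_iff _).2 (phi_mem_piCone hirr hy))
  | mkOf_mul I p hp x hx ih =>
    intro y z hy hz hxz hyz
    have hpz := lle_trans (lle_self_mul (mkOf adj G p) hx) hxz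
    obtain ⟨p', hp', hpk, hkz, hlub₁⟩ := exists_join_mkOf hsymm hirr hqlo hy hp hz hpz hyz
    have hyk := lle_self_mul (P := posCone adj G Pc) y (mkOf_mem_posCone (adj := adj) hp')
    generalize y * mkOf adj G p' = k at *
    obtain ⟨m, hxm, hkm, hmz, hlub₂⟩ := ih (y := (mkOf adj G p)⁻¹ * k) hpk hpz
      ((lle_mul_left_iff' _ _ _).1 hxz) ((lle_mul_left_iff _ _ _).2 hkz)
    refine ⟨mkOf adj G p * m, (lle_mul_left_iff _ _ _).2 hxm, lle_trans hyk ?_,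
      (lle_mul_left_iff' _ _ _).2 hmz, ?_⟩
    · simpa using (lle_mul_left_iff (mkOf adj G p) _ _).2 hkm
    · have hlub := hlub₂.mul_left (phi adj G hirr (mkOf adj G p))
      simp only [← map_mul, mul_inv_cancel_left] at hlub
      exact hlub₁.of_lle hlub (lle_phi hirr (lle_self_mul _ hx))

end Join

/-- Proposition 4.5. Let `(G,P)` be a graph product of quasi-lattice
ordered groups.  The canonical homomorphism `φ` to the direct product (with
coordinatewise order) is order preserving and, whenever `x, y ∈ P` have a common upper
bound in `P`: (a) `φ(x) = φ(y)` only if `x = y`; and (b) `φ(x) ∨ φ(y) = φ(x ∨ y)`. -/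
theorem phi_order_preserving_and_join {Λ : Type u} [DecidableEq Λ]
    (adj : Λ → Λ → Prop) (hsymm : Symmetric adj) (hirr : ∀ I : Λ, ¬ adj I I)
    (G : Λ → Type v) [∀ I, Group (G I)]
    (Pc : ∀ I, Submonoid (G I)) (hqlo : ∀ I, IsQLO (Pc I)) :
    (∀ u v : GraphProduct adj G, lle (posCone adj G Pc) u v →
      lle (piCone G Pc) (phi adj G hirr u) (phi adj G hirr v)) ∧
    (∀ x y : GraphProduct adj G, x ∈ posCone adj G Pc → y ∈ posCone adj G Pc →
      (∃ z ∈ posCone adj G Pc, lle (posCone adj G Pc) x z ∧ lle (posCone adj G Pc) y z) →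
      ((phi adj G hirr x = phi adj G hirr y → x = y) ∧
        ∀ m : GraphProduct adj G, IsLub' (posCone adj G Pc) x y m →
          IsLub' (piCone G Pc) (phi adj G hirr x) (phi adj G hirr y)
            (phi adj G hirr m))) := by
  have hP : ∀ I, IsPoGroup (Pc I) := fun I => (hqlo I).1
  refine ⟨fun u v h => lle_phi hirr h, ?_⟩
  rintro x y hx hy ⟨z, hz, hxz, hyz⟩
  obtain ⟨k, hxk, hyk, -, hk⟩ := exists_join hsymm hirr hqlo hx hy hz hxz hyz
  refine ⟨fun hxy => ?_, fun m hm => ?_⟩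
  · have hkx : phi adj G hirr k = phi adj G hirr x :=
      (isPoGroup_piCone hP).lle_antisymm
        (hk.2.2 _ (lle_refl _) (by rw [hxy]; exact lle_refl _)) hk.1
    have hx1 := eq_one_of_phi_eq_one hP hirr hxk (by simp [hkx])
    have hy1 := eq_one_of_phi_eq_one hP hirr hyk (by simp [hkx, hxy])
    exact (inv_mul_eq_one.1 hx1).trans (inv_mul_eq_one.1 hy1).symm
  · have hmk : phi adj G hirr m = phi adj G hirr k :=
      (isPoGroup_piCone hP).lle_antisymm (lle_phi hirr (hm.2.2 k hxk hyk))
        (hk.2.2 _ (lle_phi hirr hm.1) (lle_phi hirr hm.2.1))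
    rwa [hmk]
end

section
/- Let (G,P) be the graph product of a family (G_I,P_I)_{I∈Λ} of quasi-lattice ordered groups over a graph Γ, and let H be a Hilbert space. If {V_I : P_I → Isom(H)}_{I∈Λ} is a family of covariant isometric representations such that V_I ∗-commutes with V_J when I and J are adjacent in Γ, and V_I is orthogonal to V_J when I and J are not adjacent in Γ, then there is a unique isometric covariant representation V : P → Isom(H) such that V restricted to P_I equals V_I for every I ∈ Λ. Conversely, every covariant isometric representation of P arises this way. -/
universe u v

section Rep

variable {E : Type*} [NormedAddCommGroup E] [InnerProductSpace ℂ E] [CompleteSpace E]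
variable {H : Type*} [Group H]

/-- `V` is an isometric representation of the submonoid `P` on the Hilbert space `E`:
a unital multiplicative map whose values are isometries. -/
def IsIsomRep (P : Submonoid H) (V : ↥P → (E →L[ℂ] E)) : Prop :=
  V 1 = 1 ∧ (∀ x y : ↥P, V (x * y) = V x * V y) ∧
    ∀ x : ↥P, ContinuousLinearMap.adjoint (V x) * V x = 1

/-- `V` is covariant (in Nica's sense) for the quasi-lattice order with cone `P`:
`V_x V_x^* V_y V_y^* = V_{x ∨ y} V_{x ∨ y}^*`, with the convention `V_∞ = 0`. -/
def IsCovariantRep (P : Submonoid H) (V : ↥P → (E →L[ℂ] E)) : Prop :=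
  ∀ x y : ↥P,
    (¬ HasUB P (x : H) (y : H) →
      V x * ContinuousLinearMap.adjoint (V x) *
        (V y * ContinuousLinearMap.adjoint (V y)) = 0) ∧
    ∀ m : ↥P, IsLub' P (x : H) (y : H) (m : H) →
      V x * ContinuousLinearMap.adjoint (V x) *
        (V y * ContinuousLinearMap.adjoint (V y)) =
        V m * ContinuousLinearMap.adjoint (V m)

/-- The representations `V` and `W` `*`-commute: every `V_x` or `V_x^*` commutes with
every `W_y` or `W_y^*`. -/
def StarCommuteRep {A B : Type*} (V : A → (E →L[ℂ] E)) (W : B → (E →L[ℂ] E)) : Prop :=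
  ∀ (p : A) (q : B),
    V p * W q = W q * V p ∧
    ContinuousLinearMap.adjoint (V p) * W q = W q * ContinuousLinearMap.adjoint (V p) ∧
    V p * ContinuousLinearMap.adjoint (W q) = ContinuousLinearMap.adjoint (W q) * V p ∧
    ContinuousLinearMap.adjoint (V p) * ContinuousLinearMap.adjoint (W q) =
      ContinuousLinearMap.adjoint (W q) * ContinuousLinearMap.adjoint (V p)

end Rep

/-- The canonical inclusion of the positive cone `P_I` of a factor into the positive cone
of the graph product. -/
def inclP {Λ : Type u} (adj : Λ → Λ → Prop) (G : Λ → Type v) [∀ I, Group (G I)]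
    (Pc : ∀ I, Submonoid (G I)) (I : Λ) (p : ↥(Pc I)) : ↥(posCone adj G Pc) :=
  ⟨mkOf adj G (p : G I), Submonoid.subset_closure ⟨I, p, p.2, rfl⟩⟩

section Divisibility

variable {H : Type*} [Group H] {P : Submonoid H}

theorem lle_iff_dvd (x y : P) : lle P (x : H) (y : H) ↔ x ∣ y := by
  constructor
  · exact fun h => ⟨⟨_, h⟩, Subtype.ext (by simp)⟩
  · rintro ⟨c, rfl⟩
    simp [lle]

theorem mem_of_lle {x w : H} (hx : x ∈ P) (h : lle P x w) : w ∈ P := by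
  simpa using P.mul_mem hx h

theorem hasUB_iff_dvd (x y : P) : HasUB P (x : H) (y : H) ↔ ∃ z : P, x ∣ z ∧ y ∣ z := by
  constructor
  · rintro ⟨z, hx, hy⟩
    exact ⟨⟨z, mem_of_lle x.2 hx⟩, (lle_iff_dvd x ⟨z, _⟩).1 hx, (lle_iff_dvd y ⟨z, _⟩).1 hy⟩
  · rintro ⟨z, hx, hy⟩
    exact ⟨z, (lle_iff_dvd x z).2 hx, (lle_iff_dvd y z).2 hy⟩

theorem isLub'_iff_dvd (x y m : P) :
    IsLub' P (x : H) (y : H) (m : H) ↔ x ∣ m ∧ y ∣ m ∧ ∀ z : P, x ∣ z → y ∣ z → m ∣ z := by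
  constructor
  · rintro ⟨hx, hy, h⟩
    refine ⟨(lle_iff_dvd x m).1 hx, (lle_iff_dvd y m).1 hy, fun z hz hz' => ?_⟩
    exact (lle_iff_dvd m z).1 (h z ((lle_iff_dvd x z).2 hz) ((lle_iff_dvd y z).2 hz'))
  · rintro ⟨hx, hy, h⟩
    refine ⟨(lle_iff_dvd x m).2 hx, (lle_iff_dvd y m).2 hy, fun w hw hw' => ?_⟩
    have hwP := mem_of_lle x.2 hw
    exact (lle_iff_dvd m ⟨w, hwP⟩).2
      (h ⟨w, hwP⟩ ((lle_iff_dvd x ⟨w, hwP⟩).1 hw) ((lle_iff_dvd y ⟨w, hwP⟩).1 hw'))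

/-- In a partially ordered group the positive cone has no nontrivial units. -/
theorem IsPoGroup.eq_one_of_mul_eq_one_s12 (hP : IsPoGroup P) {x y : P} (h : x * y = 1) : x = 1 := by
  have h' : (x : H) * y = 1 := congrArg Subtype.val h
  refine Subtype.ext (hP x x.2 ?_)
  rw [inv_eq_of_mul_eq_one_right h']
  exact y.2

/-- In a quasi-lattice ordered group two positive elements with a common right multiple have
a least common right multiple in the cone. -/
theorem IsQLO.exists_lcm (hP : IsQLO P) {x y z : P} (hx : x ∣ z) (hy : y ∣ z) :
    ∃ m : P, x ∣ m ∧ y ∣ m ∧ ∀ z : P, x ∣ z → y ∣ z → m ∣ z := by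
  obtain ⟨m, hm⟩ := hP.2 x y ((hasUB_iff_dvd x y).2 ⟨z, hx, hy⟩)
  have hmP := mem_of_lle x.2 hm.1
  exact ⟨⟨m, hmP⟩, (isLub'_iff_dvd x y ⟨m, hmP⟩).1 hm⟩

end Divisibility

section Reversing

variable {M A : Type*} [Monoid M] [Ring A] [StarRing A]

/-- Either `x` and `y` have no common right multiple and `V_x^* V_y = 0`, or they have a least
common right multiple `x * a = y * b` with `b ∈ T`, and `V_x^* V_y = V_a V_b^*`. -/
def Reverses (T : Set M) (V : M →* A) (x y : M) : Prop :=
  ((∀ z, x ∣ z → ¬ y ∣ z) ∧ star (V x) * V y = 0) ∨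
    ∃ a b, b ∈ T ∧ x * a = y * b ∧ (∀ z, x ∣ z → y ∣ z → x * a ∣ z) ∧
      star (V x) * V y = V a * star (V b)

theorem Reverses.mono {T T' : Set M} {V : M →* A} {x y : M} (hT : T ⊆ T')
    (h : Reverses T V x y) : Reverses T' V x y := by
  rcases h with h | ⟨a, b, hb, h⟩
  · exact Or.inl h
  · exact Or.inr ⟨a, b, hT hb, h⟩

theorem Reverses.symm {V : M →* A} {x y : M} (h : Reverses Set.univ V x y) :
    Reverses Set.univ V y x := by
  rcases h with ⟨h, h'⟩ | ⟨a, b, -, hab, h, h'⟩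
  · exact Or.inl ⟨fun z hy hx => h z hx hy, by simpa using congrArg star h'⟩
  · refine Or.inr ⟨b, a, trivial, hab.symm, fun z hy hx => hab ▸ h z hx hy, ?_⟩
    simpa using congrArg star h'

theorem Reverses.mul_right [IsLeftCancelMul M] {T : Set M} {V : M →* A} {x y y' : M}
    (h : Reverses T V x y) (h' : ∀ b ∈ T, Reverses T V b y') : Reverses T V x (y * y') := by
  rcases h with ⟨h, h0⟩ | ⟨a, b, hb, hab, h, hV⟩
  · exact Or.inl ⟨fun z hx hy => h z hx (dvd_of_mul_right_dvd hy), by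
      rw [map_mul, ← mul_assoc, h0, zero_mul]⟩
  have key : ∀ z, x ∣ z → y * y' ∣ z → ∃ t, z = y * t ∧ b ∣ t ∧ y' ∣ t := by
    rintro z hx ⟨t, rfl⟩
    obtain ⟨s, hs⟩ := h _ hx ⟨y' * t, mul_assoc _ _ _⟩
    refine ⟨y' * t, mul_assoc _ _ _, ⟨s, ?_⟩, dvd_mul_right _ _⟩
    rw [hab, mul_assoc, mul_assoc] at hs
    exact mul_left_cancel hs
  rcases h' b hb with ⟨k, k0⟩ | ⟨c, d, hd, hcd, k, kV⟩
  · refine Or.inl ⟨fun z hx hy => ?_, ?_⟩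
    · obtain ⟨t, -, hbt, hyt⟩ := key z hx hy
      exact k t hbt hyt
    · rw [map_mul, ← mul_assoc, hV, mul_assoc, k0, mul_zero]
  · refine Or.inr ⟨a * c, d, hd, ?_, fun z hx hy => ?_, ?_⟩
    · rw [← mul_assoc, hab, mul_assoc, hcd, mul_assoc]
    · obtain ⟨t, rfl, hbt, hyt⟩ := key z hx hy
      rw [← mul_assoc, hab, mul_assoc]
      exact mul_dvd_mul_left y (k t hbt hyt)
    · rw [map_mul, ← mul_assoc, hV, mul_assoc, kV, map_mul, mul_assoc]

theorem Reverses.range_proj_mul_eq_zero {T : Set M} {V : M →* A} {x y : M}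
    (h : Reverses T V x y) (hxy : ¬ ∃ z, x ∣ z ∧ y ∣ z) :
    V x * star (V x) * (V y * star (V y)) = 0 := by
  rcases h with ⟨-, h0⟩ | ⟨a, b, -, hab, -, -⟩
  · rw [mul_assoc, ← mul_assoc (star (V x)), h0, zero_mul, mul_zero]
  · exact absurd ⟨x * a, dvd_mul_right _ _, hab ▸ dvd_mul_right _ _⟩ hxy

theorem Reverses.range_proj_mul [IsLeftCancelMul M] {T : Set M} {V : M →* A}
    (hV : ∀ x, star (V x) * V x = 1) {x y m : M}
    (h : Reverses T V x y) (hx : x ∣ m) (hy : y ∣ m) (hm : ∀ z, x ∣ z → y ∣ z → m ∣ z) :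
    V x * star (V x) * (V y * star (V y)) = V m * star (V m) := by
  rcases h with ⟨h, -⟩ | ⟨a, b, -, hab, h, h0⟩
  · exact absurd hy (h m hx)
  obtain ⟨t, rfl⟩ := h m hx hy
  obtain ⟨s, hs⟩ := hm (x * a) (dvd_mul_right _ _) (hab ▸ dvd_mul_right _ _)
  have hts : V t * V s = 1 := by
    rw [← map_mul, ← map_one V]
    refine congrArg V (mul_left_cancel (a := x * a) ?_)
    rw [← mul_assoc, ← hs, mul_one]
  have hst : star (V t) = V s := by
    rw [← mul_one (star (V t)), ← hts, ← mul_assoc, hV, one_mul]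
  calc V x * star (V x) * (V y * star (V y))
      = V x * (star (V x) * V y) * star (V y) := by simp only [mul_assoc]
    _ = V (x * a) * star (V (y * b)) := by rw [h0]; simp only [map_mul, star_mul, mul_assoc]
    _ = V (x * a) * (V t * star (V t)) * star (V (x * a)) := by
      rw [hst, hts, mul_one, hab]
    _ = V (x * a * t) * star (V (x * a * t)) := by
      rw [map_mul V (x * a) t, star_mul]; simp only [mul_assoc]

theorem star_mul_eq_of_range_proj {x y m a b : A} (hx : star x * x = 1) (hy : star y * y = 1)
    (hm : x * star x * (y * star y) = m * star m) (ha : m = x * a) (hb : m = y * b) :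
    star x * y = a * star b := by
  calc star x * y = (star x * x) * (star x * y) * (star y * y) := by rw [hx, hy, one_mul, mul_one]
    _ = star x * (x * star x * (y * star y)) * y := by simp only [mul_assoc]
    _ = star x * ((x * a) * star (y * b)) * y := by rw [hm]; nth_rw 1 [ha]; rw [hb]
    _ = (star x * x) * a * star b * (star y * y) := by simp only [star_mul, mul_assoc]
    _ = a * star b := by rw [hx, hy, one_mul, mul_one]

theorem star_mul_eq_zero_of_range_proj {x y : A} (hx : star x * x = 1) (hy : star y * y = 1)
    (h : x * star x * (y * star y) = 0) : star x * y = 0 := by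
  calc star x * y = (star x * x) * (star x * y) * (star y * y) := by rw [hx, hy, one_mul, mul_one]
    _ = star x * (x * star x * (y * star y)) * y := by simp only [mul_assoc]
    _ = 0 := by rw [h, mul_zero, zero_mul]

end Reversing

namespace GraphProduct

section FreeProductHead

open Monoid Classical in
/-- The `J`-component of the first letter of the normal form of an element of a free product. -/
noncomputable def freeHead {Λ : Type u} {G : Λ → Type v} [∀ I, Group (G I)] (J : Λ)
    (x : CoprodI G) : G J :=
  (CoprodI.Word.equivPair J (x • (CoprodI.Word.empty : CoprodI.Word G))).head

variable {Λ : Type u} {G : Λ → Type v} [∀ I, Group (G I)]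

open Monoid

theorem freeHead_one (J : Λ) : freeHead J (1 : CoprodI G) = 1 := by
  classical
  rw [freeHead, one_smul, CoprodI.Word.equivPair_eq_of_fstIdx_ne (by simp [CoprodI.Word.fstIdx])]

theorem freeHead_of_mul_same {J : Λ} (g : G J) (x : CoprodI G) :
    freeHead J (CoprodI.of g * x) = g * freeHead J x := by
  classical
  rw [freeHead, mul_smul, CoprodI.Word.equivPair_smul_same]
  rfl

theorem freeHead_of_mul_of_ne {J K : Λ} (hJK : J ≠ K) (g : G K) (x : CoprodI G)
    (hg : g * freeHead K x ≠ 1) : freeHead J (CoprodI.of g * x) = 1 := by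
  classical
  rw [freeHead, mul_smul, CoprodI.Word.of_smul_def, CoprodI.Word.rcons]
  split_ifs with h
  · exact absurd h hg
  rw [CoprodI.Word.equivPair_eq_of_fstIdx_ne]
  rw [CoprodI.Word.fstIdx_cons]
  simpa using hJK.symm

end FreeProductHead

variable {Λ : Type u} {adj : Λ → Λ → Prop} {G : Λ → Type v} [∀ I, Group (G I)]

theorem mkOf_mul {I : Λ} (x y : G I) :
    mkOf adj G (x * y) = mkOf adj G x * mkOf adj G y := by
  unfold mkOf
  rw [map_mul]
  rfl

theorem mkOf_one (I : Λ) : mkOf adj G (1 : G I) = 1 := by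
  unfold mkOf
  rw [map_one]
  rfl

theorem mkOf_comm {I J : Λ} (h : adj I J) (x : G I) (y : G J) :
    mkOf adj G x * mkOf adj G y = mkOf adj G y * mkOf adj G x := by
  have : mkOf adj G x * mkOf adj G y * (mkOf adj G x)⁻¹ * (mkOf adj G y)⁻¹ = 1 :=
    (QuotientGroup.eq_one_iff _).2 (Subgroup.subset_normalClosure ⟨I, J, x, y, h, rfl⟩)
  rw [mul_inv_eq_one, mul_inv_eq_iff_eq_mul] at this
  exact this

/-- Homomorphisms on the factors which commute along edges extend to the graph product. -/
def lift {N : Type*} [Group N] (f : ∀ I, G I →* N)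
    (hf : ∀ I J (x : G I) (y : G J), adj I J → f I x * f J y = f J y * f I x) :
    GraphProduct adj G →* N :=
  QuotientGroup.lift _ (Monoid.CoprodI.lift f) (by
    intro g hg
    refine MonoidHom.mem_ker.1 (Subgroup.normalClosure_le_normal ?_ hg)
    rintro _ ⟨I, J, x, y, h, rfl⟩
    simp [MonoidHom.mem_ker, hf I J x y h])

theorem lift_mkOf {N : Type*} [Group N] (f : ∀ I, G I →* N)
    (hf : ∀ I J (x : G I) (y : G J), adj I J → f I x * f J y = f J y * f I x)
    {I : Λ} (x : G I) : lift (adj := adj) f hf (mkOf adj G x) = f I x := by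
  change Monoid.CoprodI.lift f (Monoid.CoprodI.of x) = f I x
  simp

open Classical in
/-- The retraction of the graph product onto the free product of the factors at two
non-adjacent vertices, regarded as a subgroup of the free product of all factors. -/
noncomputable def toFree (hirr : ∀ I : Λ, ¬ adj I I) (hsymm : ∀ ⦃I J : Λ⦄, adj I J → adj J I) {I K : Λ}
    (hIK : ¬ adj I K) : GraphProduct adj G →* Monoid.CoprodI G :=
  lift (fun J => if J = I ∨ J = K then Monoid.CoprodI.of else 1) (by
    intro J L x y hJL
    by_cases hJ : J = I ∨ J = K
    · by_cases hL : L = I ∨ L = K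
      · exfalso
        rcases hJ with rfl | rfl <;> rcases hL with rfl | rfl
        exacts [hirr _ hJL, hIK hJL, hIK (hsymm hJL), hirr _ hJL]
      · simp [hL]
    · simp [hJ])

section Positive

variable {Pc : ∀ I, Submonoid (G I)}

variable (adj Pc) in
/-- The inclusion of the positive cone of a factor as a homomorphism. -/
def inclHom (I : Λ) : Pc I →* posCone adj G Pc where
  toFun := inclP adj G Pc I
  map_one' := Subtype.ext (mkOf_one I)
  map_mul' x y := Subtype.ext (mkOf_mul (x : G I) (y : G I))

theorem inclHom_comm {I J : Λ} (h : adj I J) (x : Pc I) (y : Pc J) :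
    inclHom adj Pc I x * inclHom adj Pc J y = inclHom adj Pc J y * inclHom adj Pc I x :=
  Subtype.ext (mkOf_comm h (x : G I) (y : G J))

/-- Evaluation of a word in the positive cones of the factors, under a family of
homomorphisms to a monoid. -/
def evalPos {X : Type*} [Monoid X] (φ : ∀ I, Pc I →* X) (w : List (Σ I, Pc I)) : X :=
  (w.map fun s => φ s.1 s.2).prod

theorem evalPos_nil {X : Type*} [Monoid X] (φ : ∀ I, Pc I →* X) : evalPos φ [] = 1 := rfl

theorem evalPos_cons {X : Type*} [Monoid X] (φ : ∀ I, Pc I →* X) (s : Σ I, Pc I)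
    (w : List (Σ I, Pc I)) : evalPos φ (s :: w) = φ s.1 s.2 * evalPos φ w := by
  simp [evalPos]

theorem evalPos_append {X : Type*} [Monoid X] (φ : ∀ I, Pc I →* X) (w w' : List (Σ I, Pc I)) :
    evalPos φ (w ++ w') = evalPos φ w * evalPos φ w' := by
  simp [evalPos]

theorem evalPos_inclHom_surjective (x : posCone adj G Pc) :
    ∃ w, evalPos (inclHom adj Pc) w = x := by
  obtain ⟨x, hx⟩ := x
  induction hx using Submonoid.closure_induction with
  | mem x hx =>
    obtain ⟨I, p, hp, rfl⟩ := hx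
    exact ⟨[⟨I, p, hp⟩], by simp [evalPos]; rfl⟩
  | one => exact ⟨[], rfl⟩
  | mul x y hx hy ihx ihy =>
    obtain ⟨w, hw⟩ := ihx
    obtain ⟨w', hw'⟩ := ihy
    exact ⟨w ++ w', by rw [evalPos_append, hw, hw']; rfl⟩

theorem posCone_induction {motive : posCone adj G Pc → Prop} (one : motive 1)
    (mul : ∀ I (p : Pc I) x, motive x → motive (inclHom adj Pc I p * x))
    (x : posCone adj G Pc) : motive x := by
  obtain ⟨w, rfl⟩ := evalPos_inclHom_surjective x
  induction w with
  | nil => exact one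
  | cons s w ih =>
    rw [evalPos_cons]
    exact mul _ _ _ ih

section Head

variable {hirr : ∀ I : Λ, ¬ adj I I} {hsymm : ∀ ⦃I J : Λ⦄, adj I J → adj J I} {I K : Λ} {hIK : ¬ adj I K}

variable (hirr hsymm hIK) in
/-- The first `J`-component of the retraction to the free product of the factors at `I`, `K`. -/
noncomputable def pairHead (J : Λ) (x : posCone adj G Pc) : G J :=
  freeHead J (toFree hirr hsymm hIK (x : GraphProduct adj G))

theorem pairHead_one (J : Λ) : pairHead hirr hsymm hIK J (1 : posCone adj G Pc) = 1 := by
  simp [pairHead, freeHead_one]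

theorem toFree_inclHom_mul {J : Λ} (hJ : J = I ∨ J = K) (p : Pc J) (x : posCone adj G Pc) :
    toFree hirr hsymm hIK ((inclHom adj Pc J p * x : posCone adj G Pc) : GraphProduct adj G) =
      Monoid.CoprodI.of (p : G J) * toFree hirr hsymm hIK (x : GraphProduct adj G) := by
  rw [Submonoid.coe_mul, map_mul]
  congr 1
  change toFree hirr hsymm hIK (mkOf adj G (p : G J)) = _
  rw [toFree, lift_mkOf, if_pos hJ]

theorem pairHead_same {J : Λ} (hJ : J = I ∨ J = K) (p : Pc J) (x : posCone adj G Pc) :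
    pairHead hirr hsymm hIK J (inclHom adj Pc J p * x) = p * pairHead hirr hsymm hIK J x := by
  rw [pairHead, toFree_inclHom_mul hJ, freeHead_of_mul_same]
  rfl

theorem pairHead_other {J : Λ} (hJ : ¬ (J = I ∨ J = K)) (L : Λ) (p : Pc J)
    (x : posCone adj G Pc) :
    pairHead hirr hsymm hIK L (inclHom adj Pc J p * x) = pairHead hirr hsymm hIK L x := by
  have : toFree hirr hsymm hIK (mkOf adj G (p : G J)) = 1 := by
    rw [toFree, lift_mkOf, if_neg hJ]
    rfl
  rw [pairHead, Submonoid.coe_mul, map_mul]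
  change freeHead L (toFree hirr hsymm hIK (mkOf adj G (p : G J)) * _) = _
  rw [this, one_mul]
  rfl

theorem mul_ne_one_of_mem {H : Type*} [Group H] {P : Submonoid H} (hP : IsPoGroup P) {p : P}
    (hp : p ≠ 1) {g : H} (hg : g ∈ P) : (p : H) * g ≠ 1 := fun h =>
  hp (hP.eq_one_of_mul_eq_one_s12 (y := ⟨g, hg⟩) (Subtype.ext h))

theorem pairHead_mem (hpo : ∀ I, IsPoGroup (Pc I)) (x : posCone adj G Pc) (J : Λ) :
    pairHead hirr hsymm hIK J x ∈ Pc J := by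
  induction x using posCone_induction generalizing J with
  | one => simp [pairHead_one]
  | mul L p x ih =>
    by_cases hL : L = I ∨ L = K
    · by_cases hp : p = 1
      · simpa [hp] using ih J
      by_cases hLJ : J = L
      · subst hLJ
        rw [pairHead_same hL]
        exact mul_mem p.2 (ih _)
      · rw [pairHead, toFree_inclHom_mul hL, freeHead_of_mul_of_ne hLJ]
        · exact one_mem _
        · exact mul_ne_one_of_mem (hpo L) hp (ih L)
    · rw [pairHead_other hL]
      exact ih J

theorem pairHead_ne (hpo : ∀ I, IsPoGroup (Pc I)) {J L : Λ} (hL : L = I ∨ L = K) (hJL : J ≠ L)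
    {p : Pc L} (hp : p ≠ 1) (x : posCone adj G Pc) :
    pairHead hirr hsymm hIK J (inclHom adj Pc L p * x) = 1 := by
  rw [pairHead, toFree_inclHom_mul hL, freeHead_of_mul_of_ne hJL]
  exact mul_ne_one_of_mem (hpo L) hp (pairHead_mem hpo x L)

end Head

section Extraction

open Classical in
variable (adj) in
/-- The initial part at the vertex `I` of a word in the positive cones. -/
noncomputable def initPart (I : Λ) : List (Σ J, Pc J) → Pc I
  | [] => 1
  | s :: w =>
    if h : s.1 = I then (h ▸ s.2) * initPart I w
    else if adj s.1 I ∨ s.2 = 1 then initPart I w else 1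

open Classical in
variable (adj) in
/-- What remains of a word after its initial part at the vertex `I` is removed. -/
noncomputable def initRest (I : Λ) : List (Σ J, Pc J) → List (Σ J, Pc J)
  | [] => []
  | s :: w =>
    if s.1 = I then initRest I w
    else if adj s.1 I ∨ s.2 = 1 then s :: initRest I w else s :: w

theorem initPart_cons_same {I : Λ} (p : Pc I) (w : List (Σ J, Pc J)) :
    initPart adj I (⟨I, p⟩ :: w) = p * initPart adj I w := by
  simp [initPart]

theorem initPart_cons_skip {I J : Λ} (hJ : J ≠ I) {p : Pc J} (h : adj J I ∨ p = 1)
    (w : List (Σ J, Pc J)) : initPart adj I (⟨J, p⟩ :: w) = initPart adj I w := by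
  simp only [initPart]
  rw [dif_neg hJ, if_pos h]

theorem initPart_cons_blocked {I J : Λ} (hJ : J ≠ I) {p : Pc J} (h : ¬ (adj J I ∨ p = 1))
    (w : List (Σ J, Pc J)) : initPart adj I (⟨J, p⟩ :: w) = 1 := by
  simp only [initPart]
  rw [dif_neg hJ, if_neg h]

variable {X : Type*} [Monoid X] {φ : ∀ I, Pc I →* X}

theorem evalPos_eq_initPart_mul
    (hφ : ∀ I J, adj I J → ∀ (p : Pc I) (q : Pc J), φ I p * φ J q = φ J q * φ I p)
    (I : Λ) (w : List (Σ J, Pc J)) :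
    evalPos φ w = φ I (initPart adj I w) * evalPos φ (initRest adj I w) := by
  induction w with
  | nil => simp [initPart, initRest, evalPos]
  | cons s w ih =>
    obtain ⟨J, p⟩ := s
    by_cases hJ : J = I
    · subst hJ
      rw [initPart_cons_same, evalPos_cons, map_mul, mul_assoc, ih]
      simp [initRest]
    · by_cases h : adj J I ∨ p = 1
      · have hr : initRest adj I (⟨J, p⟩ :: w) = ⟨J, p⟩ :: initRest adj I w := by
          simp only [initRest]
          rw [if_neg hJ, if_pos h]
        rw [initPart_cons_skip hJ h, hr, evalPos_cons, evalPos_cons, ih, ← mul_assoc, ← mul_assoc]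
        congr 1
        rcases h with h | rfl
        · exact hφ _ _ h _ _
        · simp
      · have hr : initRest adj I (⟨J, p⟩ :: w) = ⟨J, p⟩ :: w := by
          simp only [initRest]
          rw [if_neg hJ, if_neg h]
        rw [initPart_cons_blocked hJ h, hr, map_one, one_mul]

theorem initPart_eq_pairHead (hirr : ∀ I : Λ, ¬ adj I I) (hsymm : ∀ ⦃I J : Λ⦄, adj I J → adj J I)
    (hpo : ∀ I, IsPoGroup (Pc I)) (I : Λ) (w : List (Σ J, Pc J)) :
    ∃ (K : Λ) (hIK : ¬ adj I K), (initPart adj I w : G I) =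
      pairHead hirr hsymm hIK I (evalPos (inclHom adj Pc) w) := by
  induction w with
  | nil => exact ⟨I, hirr I, by simp [initPart, evalPos_nil, pairHead_one]⟩
  | cons s w ih =>
    obtain ⟨J, p⟩ := s
    obtain ⟨K, hIK, ih⟩ := ih
    by_cases hJ : J = I
    · subst hJ
      refine ⟨K, hIK, ?_⟩
      rw [initPart_cons_same, evalPos_cons, pairHead_same (Or.inl rfl), Submonoid.coe_mul, ih]
    · by_cases h : adj J I ∨ p = 1
      · refine ⟨K, hIK, ?_⟩
        rw [initPart_cons_skip hJ h, evalPos_cons, ih]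
        rcases h with h | rfl
        · rw [pairHead_other]
          rintro (rfl | rfl)
          · exact hirr _ h
          · exact hIK (hsymm h)
        · simp
      · have hIJ : ¬ adj I J := fun h' => h (Or.inl (hsymm h'))
        refine ⟨J, hIJ, ?_⟩
        rw [initPart_cons_blocked hJ h, evalPos_cons,
          pairHead_ne hpo (Or.inr rfl) (Ne.symm hJ) (fun hp => h (Or.inr hp))]
        rfl

theorem evalPos_eq_one_of_inclHom (hirr : ∀ I : Λ, ¬ adj I I) (hsymm : ∀ ⦃I J : Λ⦄, adj I J → adj J I)
    (hpo : ∀ I, IsPoGroup (Pc I)) (w : List (Σ J, Pc J))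
    (hw : evalPos (inclHom adj Pc) w = 1) : evalPos φ w = 1 := by
  induction w with
  | nil => rfl
  | cons s w ih =>
    obtain ⟨J, p⟩ := s
    have hp : p = 1 := by
      by_contra hp
      have h1 := pairHead_same (hirr := hirr) (hsymm := hsymm) (hIK := hirr J) (Or.inl rfl) p
        (evalPos (inclHom adj Pc) w)
      rw [evalPos_cons] at hw
      rw [hw, pairHead_one] at h1
      exact mul_ne_one_of_mem (hpo J) hp (pairHead_mem hpo _ _) h1.symm
    subst hp
    rw [evalPos_cons, map_one, one_mul] at hw ⊢
    exact ih hw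

/-- The positive cone of the graph product is presented as the graph product of the cones. -/
theorem evalPos_eq_of_inclHom (hirr : ∀ I : Λ, ¬ adj I I) (hsymm : ∀ ⦃I J : Λ⦄, adj I J → adj J I)
    (hpo : ∀ I, IsPoGroup (Pc I))
    (hφ : ∀ I J, adj I J → ∀ (p : Pc I) (q : Pc J), φ I p * φ J q = φ J q * φ I p)
    (w w' : List (Σ J, Pc J))
    (hw : evalPos (inclHom adj Pc) w = evalPos (inclHom adj Pc) w') :
    evalPos φ w = evalPos φ w' := by
  induction w generalizing w' with
  | nil => rw [evalPos_eq_one_of_inclHom hirr hsymm hpo w' hw.symm, evalPos_nil]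
  | cons s w ih =>
    obtain ⟨I, p⟩ := s
    obtain ⟨K, hIK, hK⟩ := initPart_eq_pairHead hirr hsymm hpo I w'
    rw [← hw, evalPos_cons, pairHead_same (Or.inl rfl)] at hK
    obtain ⟨c, hc⟩ : ∃ c : Pc I, initPart adj I w' = p * c :=
      ⟨⟨_, pairHead_mem hpo _ _⟩, Subtype.ext hK⟩
    have h1 := evalPos_eq_initPart_mul (φ := inclHom adj Pc)
      (fun I J h p q => inclHom_comm h p q) I w'
    rw [← hw, evalPos_cons, hc, map_mul, mul_assoc] at h1
    rw [evalPos_cons, evalPos_eq_initPart_mul hφ I w', hc, map_mul, mul_assoc,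
      ih (⟨I, c⟩ :: initRest adj I w') (by rw [evalPos_cons]; exact mul_left_cancel h1),
      evalPos_cons]

/-- The universal property of the positive cone of a graph product. -/
theorem exists_posCone_lift (hirr : ∀ I : Λ, ¬ adj I I) (hsymm : ∀ ⦃I J : Λ⦄, adj I J → adj J I)
    (hpo : ∀ I, IsPoGroup (Pc I))
    (hφ : ∀ I J, adj I J → ∀ (p : Pc I) (q : Pc J), φ I p * φ J q = φ J q * φ I p) :
    ∃ Φ : posCone adj G Pc →* X, ∀ I p, Φ (inclHom adj Pc I p) = φ I p := by
  choose word hword using evalPos_inclHom_surjective (adj := adj) (Pc := Pc)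
  have key : ∀ w, evalPos φ (word (evalPos (inclHom adj Pc) w)) = evalPos φ w := fun w =>
    evalPos_eq_of_inclHom hirr hsymm hpo hφ _ _ (hword _)
  refine ⟨⟨⟨fun x => evalPos φ (word x), ?_⟩, fun x y => ?_⟩, fun I p => ?_⟩
  · exact key []
  · change evalPos φ (word (x * y)) = evalPos φ (word x) * evalPos φ (word y)
    rw [← evalPos_append, ← key (word x ++ word y), evalPos_append, hword, hword]
  · change evalPos φ (word _) = _
    have := key [⟨I, p⟩]
    simpa [evalPos] using this

end Extraction

section InitialFunction

open Classical in
/-- The effect on initial parts at `I` of left multiplication by `p ∈ P_J`. -/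
noncomputable def initFun (adj : Λ → Λ → Prop) (I J : Λ) (p : Pc J) (c : Pc I) : Pc I :=
  if h : J = I then (h ▸ p) * c else if adj J I ∨ p = 1 then c else 1

theorem initFun_same {I : Λ} (p c : Pc I) : initFun adj I I p c = p * c := by
  simp [initFun]

theorem initFun_skip {I J : Λ} (hJ : J ≠ I) {p : Pc J} (h : adj J I ∨ p = 1) (c : Pc I) :
    initFun adj I J p c = c := by
  rw [initFun, dif_neg hJ, if_pos h]

theorem initFun_blocked {I J : Λ} (hJ : J ≠ I) {p : Pc J} (h : ¬ (adj J I ∨ p = 1)) (c : Pc I) :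
    initFun adj I J p c = 1 := by
  rw [initFun, dif_neg hJ, if_neg h]

/-- The action of `P_J` on initial parts at `I`. -/
noncomputable def initStep (adj : Λ → Λ → Prop) (hpo : ∀ I, IsPoGroup (Pc I)) (I J : Λ) :
    Pc J →* Function.End (Pc I) where
  toFun := initFun adj I J
  map_one' := by
    funext c
    change initFun adj I J 1 c = c
    by_cases h : J = I
    · subst h
      rw [initFun_same, one_mul]
    · rw [initFun_skip h (Or.inr rfl)]
  map_mul' p q := by
    funext c
    change initFun adj I J (p * q) c = initFun adj I J p (initFun adj I J q c)
    by_cases h : J = I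
    · subst h
      simp only [initFun_same, mul_assoc]
    by_cases hJ : adj J I
    · simp only [initFun_skip h (Or.inl hJ)]
    by_cases hp : p = 1
    · rw [hp, one_mul, initFun_skip h (Or.inr rfl)]
    · have hpq : p * q ≠ 1 := fun hpq => hp ((hpo J).eq_one_of_mul_eq_one_s12 hpq)
      rw [initFun_blocked h (by tauto), initFun_blocked h (by tauto)]

variable {hpo : ∀ I, IsPoGroup (Pc I)}

theorem initStep_same {I : Λ} (p c : Pc I) : initStep adj hpo I I p c = p * c :=
  initFun_same p c

theorem initStep_adj {I J : Λ} (hJ : J ≠ I) (h : adj J I) (p : Pc J) (c : Pc I) :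
    initStep adj hpo I J p c = c :=
  initFun_skip hJ (Or.inl h) c

theorem initStep_blocked {I J : Λ} (hJ : J ≠ I) (h : ¬ adj J I) {p : Pc J} (hp : p ≠ 1)
    (c : Pc I) : initStep adj hpo I J p c = 1 :=
  initFun_blocked hJ (by tauto) c

theorem initStep_comm (hirr : ∀ I : Λ, ¬ adj I I) (hsymm : ∀ ⦃I J : Λ⦄, adj I J → adj J I) (I : Λ) {J K : Λ}
    (hJK : adj J K) (p : Pc J) (q : Pc K) :
    initStep adj hpo I J p * initStep adj hpo I K q =
      initStep adj hpo I K q * initStep adj hpo I J p := by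
  by_cases hp : p = 1
  · simp [hp]
  by_cases hq : q = 1
  · simp [hq]
  funext c
  change initStep adj hpo I J p (initStep adj hpo I K q c) =
    initStep adj hpo I K q (initStep adj hpo I J p c)
  by_cases hJ : J = I
  · subst hJ
    have hK : K ≠ J := fun h => hirr J (h ▸ hJK)
    rw [initStep_adj hK (hsymm hJK), initStep_adj hK (hsymm hJK)]
  by_cases hK : K = I
  · subst hK
    rw [initStep_adj hJ hJK, initStep_adj hJ hJK]
  by_cases hJI : adj J I
  · rw [initStep_adj hJ hJI, initStep_adj hJ hJI]
  by_cases hKI : adj K I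
  · rw [initStep_adj hK hKI, initStep_adj hK hKI]
  rw [initStep_blocked hJ hJI hp, initStep_blocked hK hKI hq]

/-- Elements of the positive cone have a greatest left divisor in each factor, which behaves
as prescribed under left multiplication by elements of the factors. -/
theorem exists_initial (hirr : ∀ I : Λ, ¬ adj I I) (hsymm : ∀ ⦃I J : Λ⦄, adj I J → adj J I)
    (hpo : ∀ I, IsPoGroup (Pc I)) (I : Λ) :
    ∃ l : posCone adj G Pc → Pc I,
      (∀ p x, l (inclHom adj Pc I p * x) = p * l x) ∧
      (∀ J, adj J I → ∀ p x, l (inclHom adj Pc J p * x) = l x) ∧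
      (∀ J, J ≠ I → ¬ adj J I → ∀ p x, p ≠ 1 → l (inclHom adj Pc J p * x) = 1) ∧
      ∀ x, inclHom adj Pc I (l x) ∣ x := by
  obtain ⟨Φ, hΦ⟩ := exists_posCone_lift (φ := initStep adj hpo I) hirr hsymm hpo
    (fun J K h p q => initStep_comm hirr hsymm I h p q)
  have h0 : ∀ J p x, Φ (inclHom adj Pc J p * x) 1 = initStep adj hpo I J p (Φ x 1) := by
    intro J p x
    rw [map_mul, hΦ]
    rfl
  have h1 : ∀ p x, Φ (inclHom adj Pc I p * x) 1 = p * Φ x 1 := by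
    intro p x
    rw [h0, initStep_same]
  have h2 : ∀ J, adj J I → ∀ p x, Φ (inclHom adj Pc J p * x) 1 = Φ x 1 := by
    intro J hJ p x
    have hne : J ≠ I := fun h => hirr I (h ▸ hJ)
    rw [h0, initStep_adj hne hJ]
  have h3 : ∀ J, J ≠ I → ¬ adj J I → ∀ p x, p ≠ 1 → Φ (inclHom adj Pc J p * x) 1 = 1 := by
    intro J hne hJ p x hp
    rw [h0, initStep_blocked hne hJ hp]
  refine ⟨fun x => Φ x 1, h1, h2, h3, fun x => ?_⟩
  induction x using posCone_induction with
  | one =>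
    have : Φ (1 : posCone adj G Pc) 1 = 1 := by rw [map_one]; rfl
    simp [this]
  | mul J p x ih =>
    by_cases hJ : J = I
    · subst hJ
      simp only [h1, map_mul]
      exact mul_dvd_mul_left _ ih
    by_cases hJI : adj J I
    · simp only [h2 J hJI]
      obtain ⟨r, hr⟩ := ih
      refine ⟨inclHom adj Pc J p * r, ?_⟩
      rw [← mul_assoc, ← inclHom_comm hJI, mul_assoc, ← hr]
    by_cases hp : p = 1
    · simpa [hp] using ih
    · simp [h3 J hJ hJI p x hp]

end InitialFunction

section Divisors

theorem exists_dvd_of_inclHom_dvd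
    (hirr : ∀ I : Λ, ¬ adj I I) (hsymm : ∀ ⦃I J : Λ⦄, adj I J → adj J I)
    (hpo : ∀ I, IsPoGroup (Pc I)) {I : Λ} (x : posCone adj G Pc) :
    ∃ l : Pc I, inclHom adj Pc I l ∣ x ∧ ∀ p, inclHom adj Pc I p ∣ x → p ∣ l := by
  obtain ⟨l, h1, -, -, h4⟩ := exists_initial (Pc := Pc) hirr hsymm hpo I
  refine ⟨l x, h4 x, ?_⟩
  rintro p ⟨y, rfl⟩
  rw [h1]
  exact dvd_mul_right _ _

theorem mul_dvd_of_adj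
    (hirr : ∀ I : Λ, ¬ adj I I) (hsymm : ∀ ⦃I J : Λ⦄, adj I J → adj J I)
    (hpo : ∀ I, IsPoGroup (Pc I)) {I J : Λ} (hIJ : adj I J) {p : Pc I} {q : Pc J} {x : posCone adj G Pc}
    (hp : inclHom adj Pc I p ∣ x) (hq : inclHom adj Pc J q ∣ x) :
    inclHom adj Pc I p * inclHom adj Pc J q ∣ x := by
  obtain ⟨l, h1, h2, -, h4⟩ := exists_initial (Pc := Pc) hirr hsymm hpo J
  obtain ⟨y, rfl⟩ := hp
  obtain ⟨z, hz⟩ := hq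
  refine mul_dvd_mul_left _ (dvd_trans ?_ (h4 y))
  have := h2 I hIJ p y
  rw [hz, h1] at this
  rw [← this, map_mul]
  exact dvd_mul_right _ _

theorem not_dvd_of_not_adj
    (hirr : ∀ I : Λ, ¬ adj I I) (hsymm : ∀ ⦃I J : Λ⦄, adj I J → adj J I)
    (hpo : ∀ I, IsPoGroup (Pc I)) {I J : Λ} (hne : I ≠ J) (hIJ : ¬ adj I J) {p : Pc I} {q : Pc J}
    (hp1 : p ≠ 1) (hq1 : q ≠ 1) {x : posCone adj G Pc}
    (hp : inclHom adj Pc I p ∣ x) : ¬ inclHom adj Pc J q ∣ x := by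
  obtain ⟨l, h1, -, h3, -⟩ := exists_initial (Pc := Pc) hirr hsymm hpo J
  obtain ⟨y, rfl⟩ := hp
  rintro ⟨z, hz⟩
  have := h3 I hne hIJ p y hp1
  rw [hz, h1] at this
  exact hq1 ((hpo J).eq_one_of_mul_eq_one_s12 this)

end Divisors

/-- If the restrictions of `V` to the factors reverse generators, then `V` reverses everything. -/
theorem reverses_of_generators {A : Type*} [Ring A] [StarRing A] {V : posCone adj G Pc →* A}
    (h : ∀ I J (p : Pc I) (q : Pc J),
      Reverses (Set.range (inclHom adj Pc I)) V (inclHom adj Pc I p) (inclHom adj Pc J q))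
    (x y : posCone adj G Pc) : Reverses Set.univ V x y := by
  have h1 : ∀ (x : posCone adj G Pc) (T : Set (posCone adj G Pc)), x ∈ T →
      Reverses T V x 1 := fun x T hx =>
    Or.inr ⟨1, x, hx, by simp, fun z hz _ => by simpa using hz, by simp⟩
  have gen : ∀ I (p : Pc I) y,
      Reverses (Set.range (inclHom adj Pc I)) V (inclHom adj Pc I p) y := by
    intro I p y
    induction y using posCone_induction generalizing p with
    | one => exact h1 _ _ ⟨p, rfl⟩
    | mul J q y ih =>
      refine (h I J p q).mul_right ?_
      rintro _ ⟨b, rfl⟩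
      exact ih b
  induction y using posCone_induction generalizing x with
  | one => exact h1 _ _ trivial
  | mul J q y ih =>
    exact ((gen J q x).mono (Set.subset_univ _)).symm.mul_right fun b _ => ih b

end Positive

end GraphProduct

namespace GraphProduct

variable {E : Type*} [NormedAddCommGroup E] [InnerProductSpace ℂ E] [CompleteSpace E]
variable {Λ : Type u} {adj : Λ → Λ → Prop} {G : Λ → Type v} [∀ I, Group (G I)]
variable {Pc : ∀ I, Submonoid (G I)}

/-- An isometric representation as a monoid homomorphism. -/
def repHom {H : Type*} [Group H] {P : Submonoid H} {V : P → (E →L[ℂ] E)}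
    (hV : IsIsomRep P V) : P →* (E →L[ℂ] E) where
  toFun := V
  map_one' := hV.1
  map_mul' := hV.2.1

theorem coe_ne_one {H : Type*} [Group H] {P : Submonoid H} {p : P} (hp : p ≠ 1) : (p : H) ≠ 1 :=
  fun h => hp (Subtype.ext h)

theorem inclHom_lcm_dvd (hirr : ∀ I : Λ, ¬ adj I I)
    (hsymm : ∀ ⦃I J : Λ⦄, adj I J → adj J I) (hpo : ∀ I, IsPoGroup (Pc I)) {I : Λ} {p q m : Pc I}
    (hm : ∀ z, p ∣ z → q ∣ z → m ∣ z) (x : posCone adj G Pc)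
    (hpx : inclHom adj Pc I p ∣ x) (hqx : inclHom adj Pc I q ∣ x) : inclHom adj Pc I m ∣ x := by
  obtain ⟨l, hl, h⟩ := exists_dvd_of_inclHom_dvd hirr hsymm hpo (I := I) x
  exact ((inclHom adj Pc I).map_dvd (hm l (h p hpx) (h q hqx))).trans hl

section Existence

theorem reverses_inclHom
    (hirr : ∀ I : Λ, ¬ adj I I) (hsymm : ∀ ⦃I J : Λ⦄, adj I J → adj J I)
    (hqlo : ∀ I, IsQLO (Pc I)) (V : ∀ I : Λ, Pc I → (E →L[ℂ] E))
    (hV : ∀ I, IsIsomRep (Pc I) (V I))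
    (hcov : ∀ I, IsCovariantRep (Pc I) (V I))
    (hcomm : ∀ I J : Λ, adj I J → StarCommuteRep (V I) (V J))
    (horth : ∀ I J : Λ, I ≠ J → ¬ adj I J → ∀ (p : Pc I) (q : Pc J),
      (p : G I) ≠ 1 → (q : G J) ≠ 1 → ContinuousLinearMap.adjoint (V I p) * V J q = 0)
    {Φ : posCone adj G Pc →* (E →L[ℂ] E)} (hΦ : ∀ I p, Φ (inclHom adj Pc I p) = V I p)
    (I J : Λ) (p : Pc I) (q : Pc J) :
    Reverses (Set.range (inclHom adj Pc I)) Φ (inclHom adj Pc I p) (inclHom adj Pc J q) := by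
  have hpo : ∀ I, IsPoGroup (Pc I) := fun I => (hqlo I).1
  by_cases hIJ : adj I J
  · refine Or.inr ⟨inclHom adj Pc J q, _, ⟨p, rfl⟩, inclHom_comm hIJ p q,
      fun z hp hq => mul_dvd_of_adj hirr hsymm hpo hIJ hp hq, ?_⟩
    rw [hΦ, hΦ]
    exact (hcomm I J hIJ p q).2.1
  by_cases hne : I = J
  · subst hne
    by_cases hz : ∃ z, p ∣ z ∧ q ∣ z
    · obtain ⟨z, hpz, hqz⟩ := hz
      obtain ⟨m, hpm, hqm, hm⟩ := (hqlo I).exists_lcm hpz hqz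
      have hcov' := (hcov I p q).2 m ((isLub'_iff_dvd p q m).2 ⟨hpm, hqm, hm⟩)
      have hdvd := inclHom_lcm_dvd hirr hsymm hpo hm
      obtain ⟨a, ha⟩ := hpm
      obtain ⟨b, hb⟩ := hqm
      refine Or.inr ⟨inclHom adj Pc I a, inclHom adj Pc I b, ⟨b, rfl⟩, ?_, ?_, ?_⟩
      · rw [← map_mul, ← map_mul, ← ha, ← hb]
      · rw [← map_mul, ← ha]
        exact hdvd
      · simp only [hΦ]
        exact star_mul_eq_of_range_proj ((hV I).2.2 p) ((hV I).2.2 q) hcov'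
          (by rw [ha, (hV I).2.1]) (by rw [hb, (hV I).2.1])
    · refine Or.inl ⟨fun z hp hq => ?_, ?_⟩
      · obtain ⟨l, -, hl⟩ := exists_dvd_of_inclHom_dvd hirr hsymm hpo (I := I) z
        exact hz ⟨l, hl p hp, hl q hq⟩
      · simp only [hΦ]
        refine star_mul_eq_zero_of_range_proj ((hV I).2.2 p) ((hV I).2.2 q) ?_
        exact (hcov I p q).1 (mt (hasUB_iff_dvd p q).1 hz)
  by_cases hp : p = 1
  · subst hp
    exact Or.inr ⟨inclHom adj Pc J q, 1, ⟨1, map_one _⟩, by simp, fun z _ hz => by simpa using hz,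
      by simp⟩
  by_cases hq : q = 1
  · subst hq
    exact Or.inr ⟨1, inclHom adj Pc I p, ⟨p, rfl⟩, by simp, fun z hz _ => by simpa using hz,
      by simp⟩
  refine Or.inl ⟨fun z => not_dvd_of_not_adj hirr hsymm hpo hne hIJ hp hq, ?_⟩
  rw [hΦ, hΦ]
  exact horth I J hne hIJ p q (coe_ne_one hp) (coe_ne_one hq)

theorem existsUnique_covariant_extension
    (hirr : ∀ I : Λ, ¬ adj I I) (hsymm : ∀ ⦃I J : Λ⦄, adj I J → adj J I)
    (hqlo : ∀ I, IsQLO (Pc I)) (V : ∀ I : Λ, Pc I → (E →L[ℂ] E))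
    (hV : ∀ I, IsIsomRep (Pc I) (V I))
    (hcov : ∀ I, IsCovariantRep (Pc I) (V I))
    (hcomm : ∀ I J : Λ, adj I J → StarCommuteRep (V I) (V J))
    (horth : ∀ I J : Λ, I ≠ J → ¬ adj I J → ∀ (p : Pc I) (q : Pc J),
      (p : G I) ≠ 1 → (q : G J) ≠ 1 → ContinuousLinearMap.adjoint (V I p) * V J q = 0) :
    ∃! W : posCone adj G Pc → (E →L[ℂ] E),
      IsIsomRep (posCone adj G Pc) W ∧ IsCovariantRep (posCone adj G Pc) W ∧
        ∀ (I : Λ) (p : Pc I), W (inclP adj G Pc I p) = V I p := by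
  have hpo : ∀ I, IsPoGroup (Pc I) := fun I => (hqlo I).1
  obtain ⟨Φ, hΦ⟩ := exists_posCone_lift (φ := fun I => repHom (hV I)) hirr hsymm hpo
    (fun I J h p q => (hcomm I J h p q).1)
  have hisom : ∀ x, star (Φ x) * Φ x = 1 := by
    intro x
    induction x using posCone_induction with
    | one => simp
    | mul I p x ih =>
      have hp : star (Φ (inclHom adj Pc I p)) * Φ (inclHom adj Pc I p) = 1 := by
        rw [hΦ]
        exact (hV I).2.2 p
      rw [map_mul, star_mul, mul_assoc, ← mul_assoc (star (Φ (inclHom adj Pc I p))), hp, one_mul,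
        ih]
  have hrev := reverses_of_generators
    (reverses_inclHom hirr hsymm hqlo V hV hcov hcomm horth hΦ)
  refine ⟨Φ, ⟨⟨map_one Φ, map_mul Φ, hisom⟩, fun x y => ⟨fun h => ?_, fun m hm => ?_⟩, hΦ⟩, ?_⟩
  · exact (hrev x y).range_proj_mul_eq_zero (mt (hasUB_iff_dvd x y).2 h)
  · obtain ⟨hx, hy, hm⟩ := (isLub'_iff_dvd x y m).1 hm
    exact (hrev x y).range_proj_mul hisom hx hy hm
  · rintro W ⟨hW, -, hWV⟩
    funext x
    induction x using posCone_induction with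
    | one => rw [hW.1, map_one]
    | mul I p x ih =>
      rw [hW.2.1, map_mul, ih, hΦ]
      exact congrArg (· * Φ x) (hWV I p)

end Existence

section Restriction

variable {W : posCone adj G Pc → (E →L[ℂ] E)}

theorem isIsomRep_restrict (hW : IsIsomRep (posCone adj G Pc) W) (I : Λ) :
    IsIsomRep (Pc I) (fun p => W (inclP adj G Pc I p)) :=
  ⟨(congrArg W (map_one (inclHom adj Pc I))).trans hW.1,
    fun x y => (congrArg W (map_mul (inclHom adj Pc I) x y)).trans (hW.2.1 _ _),
    fun _ => hW.2.2 _⟩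

theorem isCovariantRep_restrict
    (hirr : ∀ I : Λ, ¬ adj I I) (hsymm : ∀ ⦃I J : Λ⦄, adj I J → adj J I)
    (hpo : ∀ I, IsPoGroup (Pc I)) (hWcov : IsCovariantRep (posCone adj G Pc) W) (I : Λ) :
    IsCovariantRep (Pc I) (fun p => W (inclP adj G Pc I p)) := by
  refine fun p q => ⟨fun h => ?_, fun m hm => ?_⟩
  · refine (hWcov (inclHom adj Pc I p) (inclHom adj Pc I q)).1 fun hub => h ?_
    obtain ⟨z, hp, hq⟩ := (hasUB_iff_dvd _ _).1 hub
    obtain ⟨l, -, hl⟩ := exists_dvd_of_inclHom_dvd hirr hsymm hpo (I := I) z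
    exact (hasUB_iff_dvd p q).2 ⟨l, hl p hp, hl q hq⟩
  · obtain ⟨hp, hq, hm⟩ := (isLub'_iff_dvd p q m).1 hm
    exact (hWcov (inclHom adj Pc I p) (inclHom adj Pc I q)).2 (inclHom adj Pc I m)
      ((isLub'_iff_dvd _ _ _).2 ⟨(inclHom adj Pc I).map_dvd hp, (inclHom adj Pc I).map_dvd hq,
        inclHom_lcm_dvd hirr hsymm hpo hm⟩)

theorem starCommuteRep_restrict
    (hirr : ∀ I : Λ, ¬ adj I I) (hsymm : ∀ ⦃I J : Λ⦄, adj I J → adj J I)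
    (hpo : ∀ I, IsPoGroup (Pc I)) (hW : IsIsomRep (posCone adj G Pc) W)
    (hWcov : IsCovariantRep (posCone adj G Pc) W) {I J : Λ} (hIJ : adj I J) :
    StarCommuteRep (fun p : Pc I => W (inclP adj G Pc I p))
      (fun q : Pc J => W (inclP adj G Pc J q)) := by
  have comm : ∀ {K L : Λ}, adj K L → ∀ (p : Pc K) (q : Pc L),
      W (inclHom adj Pc K p) * W (inclHom adj Pc L q) =
        W (inclHom adj Pc L q) * W (inclHom adj Pc K p) := by
    intro K L h p q
    rw [← hW.2.1, ← hW.2.1, inclHom_comm h]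
  have starComm : ∀ {K L : Λ}, adj K L → ∀ (p : Pc K) (q : Pc L),
      star (W (inclHom adj Pc K p)) * W (inclHom adj Pc L q) =
        W (inclHom adj Pc L q) * star (W (inclHom adj Pc K p)) := by
    intro K L h p q
    refine star_mul_eq_of_range_proj (hW.2.2 _) (hW.2.2 _)
      ((hWcov (inclHom adj Pc K p) (inclHom adj Pc L q)).2
        (inclHom adj Pc K p * inclHom adj Pc L q) ?_) (hW.2.1 _ _) ?_
    · refine (isLub'_iff_dvd _ _ _).2 ⟨dvd_mul_right _ _, ?_,
        fun z hp hq => mul_dvd_of_adj hirr hsymm hpo h hp hq⟩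
      rw [inclHom_comm h]
      exact dvd_mul_right _ _
    · rw [inclHom_comm h, hW.2.1]
  intro p q
  refine ⟨comm hIJ p q, starComm hIJ p q, (starComm (hsymm hIJ) q p).symm, ?_⟩
  have h := congrArg star (comm hIJ p q).symm
  rw [star_mul, star_mul] at h
  exact h

theorem orthogonal_restrict
    (hirr : ∀ I : Λ, ¬ adj I I) (hsymm : ∀ ⦃I J : Λ⦄, adj I J → adj J I)
    (hpo : ∀ I, IsPoGroup (Pc I)) (hW : IsIsomRep (posCone adj G Pc) W)
    (hWcov : IsCovariantRep (posCone adj G Pc) W) {I J : Λ} (hne : I ≠ J) (hIJ : ¬ adj I J)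
    {p : Pc I} {q : Pc J} (hp : (p : G I) ≠ 1) (hq : (q : G J) ≠ 1) :
    ContinuousLinearMap.adjoint (W (inclP adj G Pc I p)) * W (inclP adj G Pc J q) = 0 := by
  refine star_mul_eq_zero_of_range_proj (hW.2.2 _) (hW.2.2 _)
    ((hWcov (inclHom adj Pc I p) (inclHom adj Pc J q)).1 fun hub => ?_)
  obtain ⟨z, hpz, hqz⟩ := (hasUB_iff_dvd _ _).1 hub
  exact not_dvd_of_not_adj hirr hsymm hpo hne hIJ (fun h => hp (congrArg Subtype.val h))
    (fun h => hq (congrArg Subtype.val h)) hpz hqz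

end Restriction

end GraphProduct

/-- Theorem 4.7(i). Let `(G,P)` be the graph product of a family of
quasi-lattice ordered groups `(G_I, P_I)` over a simplicial graph.  (1) If
`V_I : P_I → Isom(E)` is a family of covariant isometric representations such that `V_I`
`*`-commutes with `V_J` when `I, J` are adjacent and `V_I` is orthogonal to `V_J`
(`V_p^* W_q = 0` for nontrivial `p, q`) when `I, J` are not adjacent, then there is a
unique isometric covariant representation `W` of `P` with `W|_{P_I} = V_I` for all `I`.
(2) Conversely, every covariant isometric representation of `P` arises this way: its
restrictions to the `P_I` form such a family. -/
theorem graphProduct_covariant_representations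
    {E : Type*} [NormedAddCommGroup E] [InnerProductSpace ℂ E] [CompleteSpace E]
    {Λ : Type u} (adj : Λ → Λ → Prop)
    (hsymm : Symmetric adj) (hirr : ∀ I : Λ, ¬ adj I I)
    (G : Λ → Type v) [∀ I, Group (G I)]
    (Pc : ∀ I, Submonoid (G I)) (hqlo : ∀ I, IsQLO (Pc I)) :
    (∀ V : ∀ I : Λ, ↥(Pc I) → (E →L[ℂ] E),
      (∀ I, IsIsomRep (Pc I) (V I)) →
      (∀ I, IsCovariantRep (Pc I) (V I)) →
      (∀ I J : Λ, adj I J → StarCommuteRep (V I) (V J)) →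
      (∀ I J : Λ, I ≠ J → ¬ adj I J → ∀ (p : ↥(Pc I)) (q : ↥(Pc J)),
        (p : G I) ≠ 1 → (q : G J) ≠ 1 →
        ContinuousLinearMap.adjoint (V I p) * V J q = 0) →
      ∃! W : ↥(posCone adj G Pc) → (E →L[ℂ] E),
        IsIsomRep (posCone adj G Pc) W ∧ IsCovariantRep (posCone adj G Pc) W ∧
        ∀ (I : Λ) (p : ↥(Pc I)), W (inclP adj G Pc I p) = V I p) ∧
    (∀ W : ↥(posCone adj G Pc) → (E →L[ℂ] E),
      IsIsomRep (posCone adj G Pc) W → IsCovariantRep (posCone adj G Pc) W →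
      (∀ I : Λ, IsIsomRep (Pc I) (fun p => W (inclP adj G Pc I p)) ∧
        IsCovariantRep (Pc I) (fun p => W (inclP adj G Pc I p))) ∧
      (∀ I J : Λ, adj I J →
        StarCommuteRep (fun p : ↥(Pc I) => W (inclP adj G Pc I p))
          (fun q : ↥(Pc J) => W (inclP adj G Pc J q))) ∧
      (∀ I J : Λ, I ≠ J → ¬ adj I J → ∀ (p : ↥(Pc I)) (q : ↥(Pc J)),
        (p : G I) ≠ 1 → (q : G J) ≠ 1 →
        ContinuousLinearMap.adjoint (W (inclP adj G Pc I p)) * W (inclP adj G Pc J q) = 0)) := by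
  have hpo : ∀ I, IsPoGroup (Pc I) := fun I => (hqlo I).1
  refine ⟨fun V hV hcov hcomm horth => ?_, fun W hW hWcov => ?_⟩
  · exact GraphProduct.existsUnique_covariant_extension hirr hsymm hqlo V hV hcov hcomm horth
  · refine ⟨fun I => ⟨?_, ?_⟩, ?_, ?_⟩
    · exact GraphProduct.isIsomRep_restrict hW I
    · exact GraphProduct.isCovariantRep_restrict hirr hsymm hpo hWcov I
    · exact fun I J h => GraphProduct.starCommuteRep_restrict hirr hsymm hpo hW hWcov h
    · exact fun I J hne h p q hp hq =>
        GraphProduct.orthogonal_restrict hirr hsymm hpo hW hWcov hne h hp hq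
end

section
/- Let M be a Coxeter matrix over a finite set Λ. The Artin group A_M is amenable as a group if and only if it is the free abelian group on Λ, that is, if and only if m_{s,t} = 2 for all s, t ∈ Λ with s ≠ t. -/
/-- A discrete group `G` is amenable if there is a left-invariant mean on `ℓ∞(G)`:
a positive linear functional `μ` on the bounded (automatically continuous, for the
discrete topology) real functions on `G` with `μ(1) = 1` and `μ(g·f) = μ(f)`. -/
def IsAmenable (G : Type*) [Group G] : Prop :=
  letI : TopologicalSpace G := ⊥
  haveI : DiscreteTopology G := ⟨rfl⟩
  ∃ μ : BoundedContinuousFunction G ℝ →ₗ[ℝ] ℝ,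
    (∀ f : BoundedContinuousFunction G ℝ, (∀ x, 0 ≤ f x) → 0 ≤ μ f) ∧
    μ 1 = 1 ∧
    ∀ (g : G) (f : BoundedContinuousFunction G ℝ),
      μ (f.compContinuous ⟨fun x => g * x, continuous_of_discreteTopology⟩) = μ f

variable {Λ : Type*}

/-- The alternating word `⟨st⟩^m = sts⋯` of length `m` in the free group. -/
def altWord (s t : Λ) : ℕ → FreeGroup Λ
  | 0 => 1
  | n + 1 => FreeGroup.of s * altWord t s n

/-- `M` is a Coxeter matrix: symmetric, `1` on the diagonal, and at least `2`
off the diagonal (`∞` being allowed, as the value `⊤` of `ℕ∞`). -/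
def IsCoxeterMatrix (M : Λ → Λ → ℕ∞) : Prop :=
  (∀ s t, M s t = M t s) ∧ (∀ s, M s s = 1) ∧ ∀ s t, s ≠ t → 2 ≤ M s t

/-- The Artin relators of the Coxeter matrix `M`: `⟨st⟩^{m_{s,t}} (⟨ts⟩^{m_{s,t}})⁻¹`
for `m_{s,t} ≠ ∞` (relations with `m_{s,t} = ∞` are vacuous). -/
def ArtinRels (M : Λ → Λ → ℕ∞) : Set (FreeGroup Λ) :=
  {r | ∃ (s t : Λ) (m : ℕ), s ≠ t ∧ M s t = (m : ℕ∞) ∧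
    r = altWord s t m * (altWord t s m)⁻¹}

/-- The Artin group of the Coxeter matrix `M`:
`⟨ Λ ∣ ⟨st⟩^{m_{s,t}} = ⟨ts⟩^{m_{s,t}} ⟩`. -/
def ArtinGroup (M : Λ → Λ → ℕ∞) : Type _ := PresentedGroup (ArtinRels M)

instance (M : Λ → Λ → ℕ∞) : Group (ArtinGroup M) :=
  inferInstanceAs (Group (PresentedGroup _))

section Braid

variable {A : Type*} [Ring A]

/-- The unit `1 + x`, for an element `x` of square zero. -/
def unitOneAdd (x : A) (hx : x * x = 0) : Aˣ where
  val := 1 + x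
  inv := 1 - x
  val_inv := by simp [add_mul, mul_sub, hx]
  inv_val := by simp [sub_mul, mul_add, hx]

variable [Algebra ℝ A]

/-- Closed form of the alternating products of `1 + X` and `1 + Y`, where `X` and `Y` generate
a Temperley-Lieb algebra, in terms of sequences `g` and `h`. -/
theorem lift_altWord_eq {f : Λ → Aˣ} {s t : Λ} {X Y : A} {d : ℝ} {g h : ℕ → ℝ}
    (hs : (f s : A) = 1 + X) (ht : (f t : A) = 1 + Y) (hXX : X * X = 0) (hYY : Y * Y = 0)
    (hXYX : X * (Y * X) = -(d • X)) (hYXY : Y * (X * Y) = -(d • Y))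
    (hg0 : g 0 = 0) (hh0 : h 0 = 0) (hg : ∀ k, g (k + 1) = 1 + g k - d * h k)
    (hh : ∀ k, h (k + 1) = h k + g (k + 1)) (k : ℕ) :
    ((FreeGroup.lift f (altWord s t (2 * k)) : Aˣ) : A)
      = 1 + g k • (X + Y) + h k • (X * Y) + (h k - g k) • (Y * X) ∧
    ((FreeGroup.lift f (altWord t s (2 * k)) : Aˣ) : A)
      = 1 + g k • (X + Y) + h k • (Y * X) + (h k - g k) • (X * Y) ∧
    ((FreeGroup.lift f (altWord s t (2 * k + 1)) : Aˣ) : A)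
      = 1 + g (k + 1) • X + g k • Y + h k • (X * Y + Y * X) ∧
    ((FreeGroup.lift f (altWord t s (2 * k + 1)) : Aˣ) : A)
      = 1 + g (k + 1) • Y + g k • X + h k • (X * Y + Y * X) := by
  have hX (Z : A) : X * (X * Z) = 0 := by rw [← mul_assoc, hXX, zero_mul]
  have hY (Z : A) : Y * (Y * Z) = 0 := by rw [← mul_assoc, hYY, zero_mul]
  have odd (k : ℕ)
      (h1 : ((FreeGroup.lift f (altWord s t (2 * k)) : Aˣ) : A)
        = 1 + g k • (X + Y) + h k • (X * Y) + (h k - g k) • (Y * X))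
      (h2 : ((FreeGroup.lift f (altWord t s (2 * k)) : Aˣ) : A)
        = 1 + g k • (X + Y) + h k • (Y * X) + (h k - g k) • (X * Y)) :
      ((FreeGroup.lift f (altWord s t (2 * k + 1)) : Aˣ) : A)
        = 1 + g (k + 1) • X + g k • Y + h k • (X * Y + Y * X) ∧
      ((FreeGroup.lift f (altWord t s (2 * k + 1)) : Aˣ) : A)
        = 1 + g (k + 1) • Y + g k • X + h k • (X * Y + Y * X) := by
    constructor <;>
    · simp only [altWord, map_mul, FreeGroup.lift_apply_of, Units.val_mul, h1, h2, hs, ht, hg,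
        mul_add, add_mul, mul_one, one_mul, mul_smul_comm, hXX, hYY, hX, hY, hXYX, hYXY]
      module
  have even (k : ℕ)
      (h1 : ((FreeGroup.lift f (altWord s t (2 * k + 1)) : Aˣ) : A)
        = 1 + g (k + 1) • X + g k • Y + h k • (X * Y + Y * X))
      (h2 : ((FreeGroup.lift f (altWord t s (2 * k + 1)) : Aˣ) : A)
        = 1 + g (k + 1) • Y + g k • X + h k • (X * Y + Y * X)) :
      ((FreeGroup.lift f (altWord s t (2 * (k + 1))) : Aˣ) : A)
        = 1 + g (k + 1) • (X + Y) + h (k + 1) • (X * Y) + (h (k + 1) - g (k + 1)) • (Y * X) ∧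
      ((FreeGroup.lift f (altWord t s (2 * (k + 1))) : Aˣ) : A)
        = 1 + g (k + 1) • (X + Y) + h (k + 1) • (Y * X)
          + (h (k + 1) - g (k + 1)) • (X * Y) := by
    rw [show 2 * (k + 1) = (2 * k + 1) + 1 by ring]
    constructor <;>
    · rw [altWord]
      simp only [map_mul, FreeGroup.lift_apply_of, Units.val_mul, h1, h2, hs, ht, hg, hh,
        mul_add, add_mul, mul_one, one_mul, mul_smul_comm, hXX, hYY, hX, hY, hXYX, hYXY]
      module
  induction k with
  | zero =>
    have h1 : ((FreeGroup.lift f (altWord s t (2 * 0)) : Aˣ) : A)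
        = 1 + g 0 • (X + Y) + h 0 • (X * Y) + (h 0 - g 0) • (Y * X) := by
      simp [altWord, hg0, hh0]
    have h2 : ((FreeGroup.lift f (altWord t s (2 * 0)) : Aˣ) : A)
        = 1 + g 0 • (X + Y) + h 0 • (Y * X) + (h 0 - g 0) • (X * Y) := by
      simp [altWord, hg0, hh0]
    exact ⟨h1, h2, odd 0 h1 h2⟩
  | succ k ih =>
    obtain ⟨h1, h2⟩ := even k ih.2.2.1 ih.2.2.2
    exact ⟨h1, h2, odd _ h1 h2⟩

open Real in
/-- The transvections `1 + X` and `1 + Y` satisfy the braid relation of length `m`, if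
`XYX = -4 cos² (π / m) X` and `YXY = -4 cos² (π / m) Y`. -/
theorem lift_altWord_comm {f : Λ → Aˣ} {s t : Λ} {X Y : A} {m : ℕ} (hm : 3 ≤ m)
    (hs : (f s : A) = 1 + X) (ht : (f t : A) = 1 + Y) (hXX : X * X = 0) (hYY : Y * Y = 0)
    (hXYX : X * (Y * X) = -((2 * cos (π / m)) ^ 2 • X))
    (hYXY : Y * (X * Y) = -((2 * cos (π / m)) ^ 2 • Y)) :
    FreeGroup.lift f (altWord s t m) = FreeGroup.lift f (altWord t s m) := by
  have hm' : (3 : ℝ) ≤ m := by exact_mod_cast hm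
  set θ : ℝ := π / m with hθ
  have hθm : m * θ = π := by rw [hθ]; field_simp
  have hθ0 : 0 < θ := div_pos pi_pos (by linarith)
  have hθ1 : θ < π / 2 := div_lt_div_of_pos_left pi_pos two_pos (by linarith)
  have hsin : sin θ ≠ 0 := (sin_pos_of_pos_of_lt_pi hθ0 (by linarith)).ne'
  have hcos : cos θ ≠ 0 := (cos_pos_of_mem_Ioo ⟨by linarith, hθ1⟩).ne'
  let g : ℕ → ℝ := fun k => -((-1) ^ k * sin (2 * k * θ) / (2 * cos θ * sin θ))
  let h : ℕ → ℝ := fun k =>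
    (sin θ - (-1) ^ k * sin (2 * k * θ + θ)) / ((2 * cos θ) ^ 2 * sin θ)
  have hg (k : ℕ) : g (k + 1) = 1 + g k - (2 * cos θ) ^ 2 * h k := by
    have e : 2 * ((k + 1 : ℕ) : ℝ) * θ = 2 * k * θ + 2 * θ := by push_cast; ring
    simp only [g, h, e, sin_add, sin_two_mul, cos_two_mul, pow_succ]
    field_simp
    ring
  have hh (k : ℕ) : h (k + 1) = h k + g (k + 1) := by
    have e : 2 * ((k + 1 : ℕ) : ℝ) * θ = 2 * k * θ + 2 * θ := by push_cast; ring
    simp only [g, h, e, sin_add, cos_add, sin_two_mul, cos_two_mul, pow_succ]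
    field_simp
    linear_combination (-2 * sin (2 * k * θ) * cos θ * (-1) ^ k) * sin_sq_add_cos_sq θ
  obtain ⟨k, hk⟩ := m.even_or_odd'
  obtain ⟨h1, h2, h3, h4⟩ := lift_altWord_eq hs ht hXX hYY hXYX hYXY (g := g) (h := h)
    (by simp [g]) (by simp [h]) hg hh k
  ext
  rcases hk with rfl | rfl
  · have : g k = 0 := by
      push_cast at hθm
      simp [g, hθm]
    rw [h1, h2, this]
    module
  · have : g (k + 1) = g k := by
      have e : (2 * k * θ) = π - θ := by push_cast at hθm; linarith
      rw [hg]
      simp only [h, e, sub_add_cancel, sin_pi]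
      field_simp
      ring
    rw [h3, h4, this]
    module

end Braid

section Amenable

variable {G : Type*} [Group G]

/-- An amenable group has no subset `D` such that `D, aD, a²D` are pairwise disjoint and
`Dᶜ, bDᶜ, b²Dᶜ` are pairwise disjoint. -/
theorem IsAmenable.false_of_disjoint (hG : IsAmenable G) {a b : G} {D : Set G}
    (hD : ∀ g ∈ D, a * g ∉ D ∧ a * (a * g) ∉ D)
    (hE : ∀ g ∈ Dᶜ, b * g ∉ Dᶜ ∧ b * (b * g) ∉ Dᶜ) : False := by
  let _ : TopologicalSpace G := ⊥
  have _ : DiscreteTopology G := ⟨rfl⟩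
  obtain ⟨μ, hpos, hone, hinv⟩ := hG
  let ind (S : Set G) : BoundedContinuousFunction G ℝ :=
    .ofNormedAddCommGroupDiscrete (S.indicator 1) 1 fun g => by
      by_cases h : g ∈ S <;> simp [h]
  have key (c : G) (S : Set G) (hS : ∀ g ∈ S, c * g ∉ S ∧ c * (c * g) ∉ S) :
      3 * μ (ind S) ≤ 1 := by
    let L (f : BoundedContinuousFunction G ℝ) : BoundedContinuousFunction G ℝ :=
      f.compContinuous ⟨fun x => c * x, continuous_of_discreteTopology⟩
    have h := hpos (1 - (ind S + L (ind S) + L (L (ind S)))) fun g => by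
      have h1 := hS g
      have h2 := hS (c * g)
      change 0 ≤ (1 : ℝ) - (S.indicator 1 g + S.indicator 1 (c * g) + S.indicator 1 (c * (c * g)))
      by_cases m1 : g ∈ S <;> by_cases m2 : c * g ∈ S <;> by_cases m3 : c * (c * g) ∈ S <;>
        simp_all
    have hL (f) : μ (L f) = μ f := hinv c f
    rw [map_sub, map_add, map_add, hL, hL, hL, hone] at h
    linarith
  have hsum : ind D + ind Dᶜ = 1 := by
    ext g
    exact Set.indicator_self_add_compl_apply D (1 : G → ℝ) g
  have h1 := key a D hD
  have h2 := key b Dᶜ hE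
  have h3 : μ (ind D) + μ (ind Dᶜ) = 1 := by rw [← map_add, hsum, hone]
  linarith

/-- A group with two elements acting on a nowhere vanishing family of pairs of complex numbers
by opposite transvections with parameters of modulus at least `1` is not amenable. -/
theorem not_isAmenable_of_transvections {V : Type*} [Nonempty V] {a b : G} {p q : G → V → ℂ}
    {k l : ℂ} (hk : 1 ≤ ‖k‖) (hl : 1 ≤ ‖l‖)
    (hap : ∀ g v, p (a * g) v = p g v) (haq : ∀ g v, q (a * g) v = q g v + k * p g v)
    (hbp : ∀ g v, p (b * g) v = p g v + l * q g v) (hbq : ∀ g v, q (b * g) v = q g v)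
    (hne : ∀ g, ∃ v, p g v ≠ 0 ∨ q g v ≠ 0) : ¬ IsAmenable G := by
  intro hG
  let w (g : G) : V := Classical.epsilon fun v => p g v ≠ 0 ∨ q g v ≠ 0
  have hw (g : G) : p g (w g) ≠ 0 ∨ q g (w g) ≠ 0 := Classical.epsilon_spec (hne g)
  have hwa (g : G) : w (a * g) = w g := by
    refine congrArg Classical.epsilon (funext fun v => propext ?_)
    rw [hap, haq]
    by_cases h : p g v = 0 <;> simp [h]
  have hwb (g : G) : w (b * g) = w g := by
    refine congrArg Classical.epsilon (funext fun v => propext ?_)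
    rw [hbp, hbq]
    by_cases h : q g v = 0 <;> simp [h]
  have est {x y c : ℂ} (hc : 3 ≤ ‖c‖) (h : ‖y‖ ≤ ‖x‖) (h' : ‖y + c * x‖ ≤ ‖x‖) : x = 0 := by
    have h1 : ‖c‖ * ‖x‖ ≤ 2 * ‖x‖ := by
      calc ‖c‖ * ‖x‖ = ‖(y + c * x) - y‖ := by rw [add_sub_cancel_left, norm_mul]
        _ ≤ ‖y + c * x‖ + ‖y‖ := norm_sub_le _ _
        _ ≤ 2 * ‖x‖ := by linarith
    have h2 := mul_le_mul_of_nonneg_right hc (norm_nonneg x)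
    exact norm_eq_zero.1 (le_antisymm (by linarith) (norm_nonneg x))
  have h3 {c : ℂ} (hc : 1 ≤ ‖c‖) : 3 ≤ ‖3 * c‖ := by
    rw [norm_mul, Complex.norm_ofNat]; linarith
  have h6 {c : ℂ} (hc : 1 ≤ ‖c‖) : 3 ≤ ‖6 * c‖ := by
    rw [norm_mul, Complex.norm_ofNat]; linarith
  refine hG.false_of_disjoint (a := a ^ 3) (b := b ^ 3)
    (D := {g | ‖q g (w g)‖ ≤ ‖p g (w g)‖}) (fun g hg => ?_) (fun g hg => ?_)
  · have hg' : ‖q g (w g)‖ ≤ ‖p g (w g)‖ := hg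
    have h0 : p g (w g) ≠ 0 := fun h => by
      have := hw g
      simp_all
    have e (c : ℂ) (hc : 3 ≤ ‖c‖) : ¬ ‖q g (w g) + c * p g (w g)‖ ≤ ‖p g (w g)‖ :=
      fun h => h0 (est hc hg' h)
    constructor
    · simpa [pow_succ, mul_assoc, hwa, hap, haq, show q g (w g) + k * p g (w g) + k * p g (w g)
        + k * p g (w g) = q g (w g) + 3 * k * p g (w g) by ring] using e _ (h3 hk)
    · simpa [pow_succ, mul_assoc, hwa, hap, haq, show q g (w g) + k * p g (w g) + k * p g (w g)
        + k * p g (w g) + k * p g (w g) + k * p g (w g) + k * p g (w g)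
        = q g (w g) + 6 * k * p g (w g) by ring] using e _ (h6 hk)
  · have hg' : ‖p g (w g)‖ < ‖q g (w g)‖ := not_le.1 hg
    have h0 : q g (w g) ≠ 0 := norm_pos_iff.1 ((norm_nonneg _).trans_lt hg')
    have e (c : ℂ) (hc : 3 ≤ ‖c‖) : ‖q g (w g)‖ ≤ ‖p g (w g) + c * q g (w g)‖ :=
      le_of_not_ge fun h => h0 (est hc hg'.le h)
    constructor
    · simpa [pow_succ, mul_assoc, hwb, hbp, hbq, show p g (w g) + l * q g (w g) + l * q g (w g)
        + l * q g (w g) = p g (w g) + 3 * l * q g (w g) by ring] using e _ (h3 hl)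
    · simpa [pow_succ, mul_assoc, hwb, hbp, hbq, show p g (w g) + l * q g (w g) + l * q g (w g)
        + l * q g (w g) + l * q g (w g) + l * q g (w g) + l * q g (w g)
        = p g (w g) + 6 * l * q g (w g) by ring] using e _ (h6 hl)

end Amenable

section Mean

open Filter Topology

variable {G : Type*} [TopologicalSpace G]

/-- `μ` is a positive linear functional with `μ 1 = 1`. -/
structure IsMean (μ : BoundedContinuousFunction G ℝ →ₗ[ℝ] ℝ) : Prop where
  nonneg : ∀ f : BoundedContinuousFunction G ℝ, (∀ x, 0 ≤ f x) → 0 ≤ μ f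
  map_one : μ 1 = 1

theorem IsMean.abs_apply_le {μ : BoundedContinuousFunction G ℝ →ₗ[ℝ] ℝ} (hμ : IsMean μ)
    {f : BoundedContinuousFunction G ℝ} {C : ℝ} (hf : ∀ x, |f x| ≤ C) : |μ f| ≤ C := by
  have h1 := hμ.nonneg (C • 1 - f) fun x => by
    simpa using (abs_le.1 (hf x)).2
  have h2 := hμ.nonneg (C • 1 + f) fun x => by
    simpa using neg_le_iff_add_nonneg'.1 (abs_le.1 (hf x)).1
  rw [map_sub, map_smul, hμ.map_one, smul_eq_mul, mul_one] at h1
  rw [map_add, map_smul, hμ.map_one, smul_eq_mul, mul_one] at h2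
  exact abs_le.2 ⟨by linarith, by linarith⟩

variable [Group G]

theorem exists_isMean : ∃ μ : BoundedContinuousFunction G ℝ →ₗ[ℝ] ℝ, IsMean μ :=
  ⟨{ toFun := fun f => f 1, map_add' := fun _ _ => rfl, map_smul' := fun _ _ => rfl },
    fun _ hf => hf 1, rfl⟩

variable [DiscreteTopology G]

/-- The left translate `x ↦ f (g * x)` of a bounded function. -/
def leftTranslate (g : G) (f : BoundedContinuousFunction G ℝ) : BoundedContinuousFunction G ℝ :=
  f.compContinuous ⟨fun x => g * x, continuous_of_discreteTopology⟩

theorem leftTranslate_mul (g h : G) (f : BoundedContinuousFunction G ℝ) :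
    leftTranslate (g * h) f = leftTranslate h (leftTranslate g f) := by
  ext x
  exact congrArg f (mul_assoc g h x)

theorem leftTranslate_one (f : BoundedContinuousFunction G ℝ) : leftTranslate 1 f = f := by
  ext x
  exact congrArg f (one_mul x)

/-- Averaging a mean along the powers of `s` yields an `s`-invariant mean, which remains
invariant under the elements commuting with `s`. -/
theorem IsMean.exists_average {μ : BoundedContinuousFunction G ℝ →ₗ[ℝ] ℝ} (hμ : IsMean μ)
    (s : G) : ∃ ν : BoundedContinuousFunction G ℝ →ₗ[ℝ] ℝ, IsMean ν ∧
      (∀ f, ν (leftTranslate s f) = ν f) ∧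
      ∀ g, Commute s g → (∀ f, μ (leftTranslate g f) = μ f) →
        ∀ f, ν (leftTranslate g f) = ν f := by
  let avg (f : BoundedContinuousFunction G ℝ) (n : ℕ) : ℝ :=
    (∑ k ∈ Finset.range (n + 1), μ (leftTranslate (s ^ k) f)) / (n + 1)
  have hbd (f : BoundedContinuousFunction G ℝ) (k : ℕ) : |μ (leftTranslate (s ^ k) f)| ≤ ‖f‖ :=
    hμ.abs_apply_le fun x => f.norm_coe_le_norm (s ^ k * x)
  have havg (f : BoundedContinuousFunction G ℝ) (n : ℕ) : avg f n ∈ Set.Icc (-‖f‖) ‖f‖ := by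
    have hn : (0 : ℝ) < n + 1 := by positivity
    rw [Set.mem_Icc, ← abs_le, abs_div, abs_of_pos hn, div_le_iff₀ hn]
    calc _ ≤ ∑ k ∈ Finset.range (n + 1), |μ (leftTranslate (s ^ k) f)| :=
          Finset.abs_sum_le_sum_abs _ _
      _ ≤ ∑ k ∈ Finset.range (n + 1), ‖f‖ := Finset.sum_le_sum fun k _ => hbd f k
      _ = ‖f‖ * (n + 1) := by simp [mul_comm]
  let U : Ultrafilter ℕ := hyperfilter ℕ
  have hlim (f : BoundedContinuousFunction G ℝ) : ∃ x, Tendsto (avg f) U (𝓝 x) := by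
    obtain ⟨x, -, hx⟩ := (isCompact_Icc (a := -‖f‖) (b := ‖f‖)).ultrafilter_le_nhds
      (U.map (avg f)) (le_principal_iff.2 (Filter.mem_map.2 (univ_mem' (havg f))))
    exact ⟨x, hx⟩
  choose ν hν using hlim
  refine ⟨{ toFun := ν, map_add' := fun f f' => ?_, map_smul' := fun c f => ?_ },
    ⟨fun f hf => ?_, ?_⟩, fun f => ?_, fun g hg hgμ f => ?_⟩
  · refine tendsto_nhds_unique (hν (f + f')) (((hν f).add (hν f')).congr fun n => ?_)
    have (k : ℕ) : μ (leftTranslate (s ^ k) (f + f'))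
        = μ (leftTranslate (s ^ k) f) + μ (leftTranslate (s ^ k) f') :=
      map_add μ (leftTranslate (s ^ k) f) (leftTranslate (s ^ k) f')
    simp only [avg, this, Finset.sum_add_distrib, add_div]
  · refine tendsto_nhds_unique (hν (c • f)) (((hν f).const_mul c).congr fun n => ?_)
    have (k : ℕ) : μ (leftTranslate (s ^ k) (c • f))
        = c * μ (leftTranslate (s ^ k) f) :=
      map_smul μ c (leftTranslate (s ^ k) f)
    simp only [avg, this, ← Finset.mul_sum, mul_div_assoc]
  · refine ge_of_tendsto' (hν f) fun n => ?_
    exact div_nonneg (Finset.sum_nonneg fun k _ => hμ.nonneg _ fun x => hf _) (by positivity)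
  · refine tendsto_nhds_unique (hν 1) (tendsto_const_nhds.congr fun n => ?_)
    have (k : ℕ) : μ (leftTranslate (s ^ k) 1) = 1 := hμ.map_one
    have hn : (n : ℝ) + 1 ≠ 0 := by positivity
    simp [avg, this, hn]
  · have h0 : Tendsto (fun n => avg (leftTranslate s f) n - avg f n) U (𝓝 0) := by
      refine Tendsto.mono_left (squeeze_zero_norm (a := fun n : ℕ => 2 * ‖f‖ / ((n : ℝ) + 1))
        (fun n => ?_) ?_) Nat.hyperfilter_le_atTop
      · have hn : (0 : ℝ) < n + 1 := by positivity
        have e (k : ℕ) : leftTranslate (s ^ k) (leftTranslate s f)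
            = leftTranslate (s ^ (k + 1)) f := by rw [pow_succ', leftTranslate_mul]
        simp only [avg, e]
        rw [← sub_div, ← Finset.sum_sub_distrib,
          Finset.sum_range_sub fun k => μ (leftTranslate (s ^ k) f), norm_div, Real.norm_eq_abs,
          Real.norm_eq_abs, abs_of_pos hn]
        gcongr
        have h1 := hbd f (n + 1)
        have h2 := hbd f 0
        have h3 := abs_sub (μ (leftTranslate (s ^ (n + 1)) f)) (μ (leftTranslate (s ^ 0) f))
        linarith
      · simpa [div_eq_mul_inv] using
          (tendsto_one_div_add_atTop_nhds_zero_nat (𝕜 := ℝ)).const_mul (2 * ‖f‖)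
    exact sub_eq_zero.1 (tendsto_nhds_unique ((hν (leftTranslate s f)).sub (hν f)) h0)
  · refine tendsto_nhds_unique (hν (leftTranslate g f)) ((hν f).congr fun n => ?_)
    have (k : ℕ) : μ (leftTranslate (s ^ k) (leftTranslate g f))
        = μ (leftTranslate (s ^ k) f) := by
      rw [← leftTranslate_mul, ← (hg.pow_left k).eq, leftTranslate_mul, hgμ]
    simp only [avg, this]

theorem exists_isMean_invariant (S : Finset G) (hS : ∀ s ∈ S, ∀ t ∈ S, Commute s t) :
    ∃ μ : BoundedContinuousFunction G ℝ →ₗ[ℝ] ℝ, IsMean μ ∧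
      ∀ g ∈ S, ∀ f, μ (leftTranslate g f) = μ f := by
  classical
  induction S using Finset.induction_on with
  | empty => simpa using exists_isMean
  | insert s S _ ih =>
    obtain ⟨μ, hμ, hμS⟩ := ih fun s hs t ht =>
      hS s (Finset.mem_insert_of_mem hs) t (Finset.mem_insert_of_mem ht)
    obtain ⟨ν, hν, hνs, hνS⟩ := hμ.exists_average s
    refine ⟨ν, hν, fun g hg => ?_⟩
    rcases Finset.mem_insert.1 hg with rfl | hg'
    · exact hνs
    · exact hνS g (hS s (Finset.mem_insert_self _ _) g hg) (hμS g hg')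

end Mean

/-- A group generated by finitely many commuting elements is amenable. -/
theorem isAmenable_of_closure_eq_top {G : Type*} [Group G] {S : Set G} (hfin : S.Finite)
    (hS : ∀ s ∈ S, ∀ t ∈ S, Commute s t) (htop : Subgroup.closure S = ⊤) : IsAmenable G := by
  let _ : TopologicalSpace G := ⊥
  have _ : DiscreteTopology G := ⟨rfl⟩
  obtain ⟨μ, hμ, hμS⟩ := exists_isMean_invariant hfin.toFinset (by simpa using hS)
  refine ⟨μ, hμ.nonneg, hμ.map_one, fun g => ?_⟩
  change ∀ f, μ (leftTranslate g f) = μ f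
  have hg : g ∈ Subgroup.closure S := htop ▸ Subgroup.mem_top g
  induction hg using Subgroup.closure_induction with
  | mem x hx => exact hμS x (hfin.mem_toFinset.2 hx)
  | one => exact fun f => by rw [leftTranslate_one]
  | mul x y _ _ hx hy => exact fun f => by rw [leftTranslate_mul, hy, hx]
  | inv x _ hx =>
    exact fun f => by rw [← hx, ← leftTranslate_mul, inv_mul_cancel, leftTranslate_one]

section Representation

open Real

/-- The complex symmetric form `i * 2 cos (π / m_{s,t})` attached to `M`, with zero diagonal;
the junk value of `ENat.toNat` gives `2 i` where `m_{s,t} = ∞`. -/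
noncomputable def artinForm (M : Λ → Λ → ℕ∞) (s t : Λ) : ℂ :=
  open Classical in if s = t then 0 else Complex.I * (2 * cos (π / (M s t).toNat) : ℝ)

/-- The functional with value `artinForm M s t` on the basis vector of `t`. -/
noncomputable def artinFunctional (M : Λ → Λ → ℕ∞) (s : Λ) : (Λ →₀ ℂ) →ₗ[ℂ] ℂ :=
  Finsupp.linearCombination ℂ (artinForm M s)

/-- The rank one endomorphism `v ↦ φ_s(v) e_s`, where `φ_s` is `artinFunctional M s`. -/
noncomputable def artinEnd (M : Λ → Λ → ℕ∞) (s : Λ) : Module.End ℂ (Λ →₀ ℂ) :=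
  (artinFunctional M s).smulRight (Finsupp.single s 1)

variable (M : Λ → Λ → ℕ∞)

theorem artinFunctional_single (s t : Λ) :
    artinFunctional M s (Finsupp.single t 1) = artinForm M s t := by
  simp [artinFunctional]

theorem artinForm_self (s : Λ) : artinForm M s s = 0 := by simp [artinForm]

theorem artinEnd_apply (s : Λ) (v : Λ →₀ ℂ) :
    artinEnd M s v = artinFunctional M s v • Finsupp.single s 1 := rfl

theorem artinEnd_mul_self (s : Λ) : artinEnd M s * artinEnd M s = 0 := by
  refine LinearMap.ext fun v => ?_
  simp only [Module.End.mul_apply, artinEnd_apply, map_smul, artinFunctional_single,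
    artinForm_self, smul_zero, zero_smul, LinearMap.zero_apply]

theorem artinEnd_mul_mul {s t : Λ} (hst : s ≠ t) (hM : M s t = M t s) :
    artinEnd M s * (artinEnd M t * artinEnd M s)
      = -((2 * cos (π / (M s t).toNat)) ^ 2 • artinEnd M s) := by
  refine LinearMap.ext fun v => ?_
  simp only [Module.End.mul_apply, artinEnd_apply, map_smul, artinFunctional_single,
    LinearMap.neg_apply, LinearMap.smul_apply]
  simp only [artinForm, hst, hst.symm, if_false, ← hM, smul_smul, ← neg_smul,
    ← Complex.coe_smul]
  congr 1
  push_cast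
  linear_combination artinFunctional M s v * (2 * Complex.cos (π / (M s t).toNat)) ^ 2
    * Complex.I_sq

theorem artinEnd_mul_eq_zero {s t : Λ} (h : artinForm M s t = 0) :
    artinEnd M s * artinEnd M t = 0 := by
  refine LinearMap.ext fun v => ?_
  simp only [Module.End.mul_apply, artinEnd_apply, map_smul, artinFunctional_single, h,
    smul_zero, zero_smul, LinearMap.zero_apply]

/-- The transvection `v ↦ v + φ_s(v) e_s`. -/
noncomputable def artinTransvection (s : Λ) : (Module.End ℂ (Λ →₀ ℂ))ˣ :=
  unitOneAdd (artinEnd M s) (artinEnd_mul_self M s)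

theorem coe_artinTransvection (s : Λ) :
    (artinTransvection M s : Module.End ℂ (Λ →₀ ℂ)) = 1 + artinEnd M s := rfl

variable {M}

theorem artinForm_eq_zero {s t : Λ} (h : M s t = 2) : artinForm M s t = 0 := by
  simp [artinForm, h]

theorem lift_artinTransvection (hM : IsCoxeterMatrix M) (r : FreeGroup Λ)
    (hr : r ∈ ArtinRels M) : FreeGroup.lift (artinTransvection M) r = 1 := by
  obtain ⟨s, t, m, hst, hm, rfl⟩ := hr
  rw [map_mul, map_inv, mul_inv_eq_one]
  have h2 : 2 ≤ m := by
    have := hM.2.2 s t hst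
    rw [hm] at this
    exact_mod_cast this
  rcases h2.eq_or_lt with rfl | h3
  · have h1 := artinEnd_mul_eq_zero M (artinForm_eq_zero hm)
    have h2 := artinEnd_mul_eq_zero M (artinForm_eq_zero ((hM.1 t s).trans hm))
    ext : 1
    simp [altWord, coe_artinTransvection, mul_add, add_mul, h1, h2]
    abel
  · have e : (M s t).toNat = m := by simp [hm]
    refine lift_altWord_comm (A := Module.End ℂ (Λ →₀ ℂ)) h3 (coe_artinTransvection M s)
      (coe_artinTransvection M t) (artinEnd_mul_self M s) (artinEnd_mul_self M t) ?_ ?_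
    · simpa only [e] using artinEnd_mul_mul M hst (hM.1 s t)
    · simpa only [e, hM.1 t s] using artinEnd_mul_mul M hst.symm (hM.1 t s)

/-- The representation of the Artin group by transvections. -/
noncomputable def artinRep (hM : IsCoxeterMatrix M) :
    ArtinGroup M →* (Module.End ℂ (Λ →₀ ℂ))ˣ :=
  PresentedGroup.toGroup (lift_artinTransvection hM)

/-- The standard generators of the Artin group. -/
def artinGen (M : Λ → Λ → ℕ∞) (s : Λ) : ArtinGroup M := PresentedGroup.of s

theorem artinFunctional_artinRep (hM : IsCoxeterMatrix M) (s t : Λ) (g : ArtinGroup M)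
    (v : Λ →₀ ℂ) :
    artinFunctional M t ((artinRep hM (artinGen M s * g) : Module.End ℂ (Λ →₀ ℂ)) v)
      = artinFunctional M t ((artinRep hM g : Module.End ℂ (Λ →₀ ℂ)) v)
        + artinForm M t s
          * artinFunctional M s ((artinRep hM g : Module.End ℂ (Λ →₀ ℂ)) v) := by
  have h : artinRep hM (artinGen M s) = artinTransvection M s :=
    PresentedGroup.toGroup.of (lift_artinTransvection hM)
  rw [map_mul, h]
  simp only [coe_artinTransvection, Units.val_mul, Module.End.mul_apply, LinearMap.add_apply,
    Module.End.one_apply, map_add, artinEnd_apply, map_smul, artinFunctional_single, smul_eq_mul]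
  ring

theorem one_le_norm_artinForm (hM : IsCoxeterMatrix M) {s t : Λ} (hst : s ≠ t)
    (h : M s t ≠ 2) : 1 ≤ ‖artinForm M s t‖ := by
  have key : 1 / 2 ≤ cos (π / (M s t).toNat) := by
    have h2 := hM.2.2 s t hst
    induction hm : M s t using ENat.recTopCoe with
    | top => norm_num
    | coe m =>
      rw [hm] at h h2
      have h3 : 3 ≤ m := by
        have h2' : 2 ≤ m := by exact_mod_cast h2
        have h' : m ≠ 2 := fun e => h (by simp [e])
        omega
      have h3' : (3 : ℝ) ≤ m := by exact_mod_cast h3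
      rw [← cos_pi_div_three, ENat.toNat_natCast]
      refine cos_le_cos_of_nonneg_of_le_pi (by positivity) (by linarith [pi_pos]) ?_
      exact div_le_div_of_nonneg_left pi_pos.le (by norm_num) h3'
  rw [artinForm, if_neg hst, norm_mul, Complex.norm_I, one_mul, Complex.norm_real, norm_eq_abs]
  exact le_abs.2 (Or.inl (by linarith))

theorem not_isAmenable_artinGroup (hM : IsCoxeterMatrix M) {s t : Λ} (hst : s ≠ t)
    (h : M s t ≠ 2) : ¬ IsAmenable (ArtinGroup M) := by
  have hs := one_le_norm_artinForm hM hst h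
  have ht := one_le_norm_artinForm hM hst.symm (hM.1 t s ▸ h)
  refine not_isAmenable_of_transvections (a := artinGen M s) (b := artinGen M t)
    (p := fun g v => artinFunctional M s ((artinRep hM g : Module.End ℂ (Λ →₀ ℂ)) v))
    (q := fun g v => artinFunctional M t ((artinRep hM g : Module.End ℂ (Λ →₀ ℂ)) v))
    ht hs ?_ ?_ ?_ ?_ fun g => ?_
  · intro g v
    exact (artinFunctional_artinRep hM _ _ g v).trans (by rw [artinForm_self, zero_mul, add_zero])
  · intro g v
    exact artinFunctional_artinRep hM s t g v
  · intro g v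
    exact artinFunctional_artinRep hM t s g v
  · intro g v
    exact (artinFunctional_artinRep hM _ _ g v).trans (by rw [artinForm_self, zero_mul, add_zero])
  · refine ⟨((artinRep hM g)⁻¹ : (Module.End ℂ (Λ →₀ ℂ))ˣ).val (Finsupp.single t 1), Or.inl ?_⟩
    rw [← Module.End.mul_apply, Units.mul_inv, Module.End.one_apply, artinFunctional_single]
    exact norm_pos_iff.1 (by linarith)

end Representation

theorem isAmenable_artinGroup [Finite Λ] {M : Λ → Λ → ℕ∞} (h : ∀ s t : Λ, s ≠ t → M s t = 2) :
    IsAmenable (ArtinGroup M) := by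
  refine isAmenable_of_closure_eq_top (S := Set.range (artinGen M)) (Set.finite_range _) ?_
    (PresentedGroup.closure_range_of _)
  rintro _ ⟨s, rfl⟩ _ ⟨t, rfl⟩
  rcases eq_or_ne s t with rfl | hst
  · exact Commute.refl _
  · have := PresentedGroup.mk_eq_mk_of_mul_inv_mem (rels := ArtinRels M)
      (x := altWord s t 2) (y := altWord t s 2) ⟨s, t, 2, hst, h s t hst, rfl⟩
    simp only [altWord, mul_one, map_mul] at this
    exact this

/-- Proposition 6.4. Let `M` be a Coxeter matrix over a finite set
`Λ`.  The Artin group `A_M` is amenable (as a group) if and only if it is the free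
abelian group on `Λ`, that is, iff `m_{s,t} = 2` for all `s ≠ t`. -/
theorem artinGroup_amenable_iff [Finite Λ] (M : Λ → Λ → ℕ∞)
    (hM : IsCoxeterMatrix M) :
    IsAmenable (ArtinGroup M) ↔ ∀ s t : Λ, s ≠ t → M s t = 2 := by
  refine ⟨fun hG s t hst => ?_, isAmenable_artinGroup⟩
  by_contra h
  exact not_isAmenable_artinGroup hM hst h hG
end
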